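/- Let k be a field of characteristic zero, X = (x_{ij}) an m×n matrix of independent indeterminates with m ≤ n, R = k[x_{ij}], and I_t(X) the ideal generated by all t×t minors of X, 1 ≤ t ≤ m. Then the asymptotic resurgence of I_t(X) equals α(I_t(X))/α̂(I_t(X)) = t(m−t+1)/m; that is, sup{ s/r : s, r positive integers, I_t(X)^{(sT)} ⊄ I_t(X)^{rT} for all sufficiently large T } = t(m−t+1)/m. -/

import Mathlib

open MvPolynomial Filter

/-- The `s`-th symbolic power of an ideal: the intersection over the associated primes `p` of
`R ⧸ I` of the contractions of `I^s` localized at `p`. -/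
noncomputable def symbolicPower {R : Type*} [CommRing R] (I : Ideal R) (s : ℕ) : Ideal R :=
  ⨅ p : {p : Ideal R // p ∈ associatedPrimes R (R ⧸ I)},
    letI : p.1.IsPrime := p.2.isPrime
    Ideal.comap (algebraMap R (Localization.AtPrime p.1))
      (Ideal.map (algebraMap R (Localization.AtPrime p.1)) (I ^ s))

/-- The least degree of a nonzero homogeneous element of an ideal of a polynomial ring. -/
noncomputable def alphaDeg {σ K : Type*} [CommSemiring K] (I : Ideal (MvPolynomial σ K)) : ℕ :=
  sInf {d | ∃ f ∈ I, f ≠ 0 ∧ MvPolynomial.IsHomogeneous f d}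

/-- The asymptotic resurgence `ρ̂(I) = sup { s/r : I⁽ˢᵀ⁾ ⊄ Iʳᵀ for all T ≫ 0 }`. -/
noncomputable def asympResurgence {R : Type*} [CommRing R] (I : Ideal R) : ℝ :=
  sSup {x : ℝ | ∃ s r : ℕ, 0 < s ∧ 0 < r ∧ x = (s : ℝ) / r ∧
    ∀ᶠ T in atTop, ¬ symbolicPower I (s * T) ≤ I ^ (r * T)}

/-- The ideal `I_t(X)` generated by the `t × t` minors of the generic `m × n` matrix
`X = (x_{ij})` of indeterminates. -/
noncomputable def genericMinors (K : Type*) [Field K] (m n t : ℕ) :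
    Ideal (MvPolynomial (Fin m × Fin n) K) :=
  Ideal.span {d | ∃ (r : Fin t → Fin m) (c : Fin t → Fin n),
    Function.Injective r ∧ Function.Injective c ∧
    d = Matrix.det (Matrix.of fun i j =>
      (MvPolynomial.X (r i, c j) : MvPolynomial (Fin m × Fin n) K))}

def minorsId {O : Type*} [CommRing O] {ι κ : Type*} (t : ℕ) (Y : Matrix ι κ O) : Ideal O :=
  Ideal.span {d | ∃ (r : Fin t → ι) (c : Fin t → κ), d = (Y.submatrix r c).det}

lemma minorsId_transpose {O : Type*} [CommRing O] {ι κ : Type*} (t : ℕ) (Y : Matrix ι κ O) :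
    minorsId t Y.transpose ≤ minorsId t Y := by
  rw [minorsId, Ideal.span_le]
  rintro d ⟨r, c, rfl⟩
  apply Ideal.subset_span
  refine ⟨c, r, ?_⟩
  rw [← Matrix.det_transpose]
  rfl

lemma minorsId_mul_left {O : Type*} [CommRing O] {ι κ μ : Type*} [Fintype μ]
    (t : ℕ) (P : Matrix ι μ O) (Y : Matrix μ κ O) :
    minorsId t (P * Y) ≤ minorsId t Y := by
  classical
  rw [minorsId, Ideal.span_le]
  rintro d ⟨r, c, rfl⟩
  have h : (P * Y).submatrix r c =
      Matrix.of fun i : Fin t => ∑ k : μ, P (r i) k • (fun j : Fin t => Y k (c j)) := by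
    ext i j
    simp [Matrix.mul_apply, Finset.sum_apply]
  have h2 : ((P * Y).submatrix r c).det =
      ∑ k : Fin t → μ, (∏ i, P (r i) (k i)) * (Y.submatrix k c).det := by
    rw [h]
    change (Matrix.detRowAlternating : (Fin t → O) [⋀^Fin t]→ₗ[O] O).toMultilinearMap
      (fun i : Fin t => ∑ k : μ, P (r i) k • (fun j : Fin t => Y k (c j))) = _
    rw [MultilinearMap.map_sum]
    refine Finset.sum_congr rfl fun k _ => ?_
    rw [MultilinearMap.map_smul_univ]
    rfl
  rw [h2]
  refine Ideal.sum_mem _ fun k _ => Ideal.mul_mem_left _ _ (Ideal.subset_span ⟨k, c, rfl⟩)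

lemma minorsId_mul_right {O : Type*} [CommRing O] {ι κ μ : Type*} [Fintype μ]
    (t : ℕ) (Y : Matrix ι μ O) (Q : Matrix μ κ O) :
    minorsId t (Y * Q) ≤ minorsId t Y := by
  have h1 := minorsId_transpose t (Y * Q).transpose
  rw [Matrix.transpose_transpose, Matrix.transpose_mul] at h1
  exact h1.trans ((minorsId_mul_left t _ _).trans (minorsId_transpose t Y))

lemma minorsId_eq_bot {O : Type*} [CommRing O] {κ : Type*} {q : ℕ}
    (t : ℕ) (hq : q < t) (Y : Matrix (Fin q) κ O) : minorsId t Y = ⊥ := by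
  rw [eq_bot_iff, minorsId, Ideal.span_le]
  rintro d ⟨r, c, rfl⟩
  have : ¬ Function.Injective r := fun h => by
    have := Fintype.card_le_of_injective r h
    simp at this
    omega
  simp only [Function.Injective, not_forall] at this
  obtain ⟨a, b, hab, hne⟩ := this
  simp only [SetLike.mem_coe, Ideal.mem_bot]
  exact Matrix.det_zero_of_row_eq hne (by ext j; simp [hab])

lemma map_genericMinors {K : Type*} [Field K] {O : Type*} [CommRing O] (m n t : ℕ)
    (F : MvPolynomial (Fin m × Fin n) K →+* O) :
    Ideal.map F (genericMinors K m n t) =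
      minorsId t (Matrix.of fun i j => F (MvPolynomial.X (i, j))) := by
  have key : ∀ (r : Fin t → Fin m) (c : Fin t → Fin n),
      F (Matrix.det (Matrix.of fun i j =>
      (MvPolynomial.X (r i, c j) : MvPolynomial (Fin m × Fin n) K))) =
      ((Matrix.of fun i j => F (MvPolynomial.X (i, j))).submatrix r c).det := by
    intro r c
    rw [RingHom.map_det]
    rfl
  apply le_antisymm
  · rw [genericMinors, Ideal.map_span, Ideal.span_le]
    rintro _ ⟨_, ⟨r, c, hr, hc, rfl⟩, rfl⟩
    exact Ideal.subset_span ⟨r, c, key r c⟩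
  · rw [minorsId, Ideal.span_le]
    rintro d ⟨r, c, rfl⟩
    by_cases hr : Function.Injective r
    · by_cases hc : Function.Injective c
      · rw [← key]
        exact Ideal.mem_map_of_mem _ (Ideal.subset_span ⟨r, c, hr, hc, rfl⟩)
      · simp only [Function.Injective, not_forall] at hc
        obtain ⟨a, b, hab, hne⟩ := hc
        rw [Matrix.det_zero_of_column_eq hne (by intro j; simp [hab])]
        exact Ideal.zero_mem _
    · simp only [Function.Injective, not_forall] at hr
      obtain ⟨a, b, hab, hne⟩ := hr
      rw [Matrix.det_zero_of_row_eq hne (by ext j; simp [hab])]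
      exact Ideal.zero_mem _

lemma genericMinors_eq {K : Type*} [Field K] (m n t : ℕ) :
    genericMinors K m n t =
      minorsId t (Matrix.of fun i j => (MvPolynomial.X (i, j) : MvPolynomial (Fin m × Fin n) K)) := by
  have := map_genericMinors (K := K) m n t (RingHom.id _)
  simpa using this

noncomputable def phiAB (K : Type*) [Field K] (m n q : ℕ) :
    MvPolynomial (Fin m × Fin n) K →ₐ[K]
      MvPolynomial ((Fin m × Fin q) ⊕ (Fin q × Fin n)) K :=
  MvPolynomial.aeval fun z => ∑ l : Fin q, MvPolynomial.X (Sum.inl (z.1, l)) *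
    MvPolynomial.X (Sum.inr (l, z.2))

lemma genericMinors_le_ker (K : Type*) [Field K] (m n q : ℕ) :
    genericMinors K m n (q + 1) ≤ RingHom.ker (phiAB K m n q) := by
  have h := map_genericMinors (K := K) m n (q + 1) (phiAB K m n q).toRingHom
  have h2 : (Matrix.of fun i j => (phiAB K m n q).toRingHom (MvPolynomial.X (i, j))) =
      (Matrix.of fun i l => (MvPolynomial.X (Sum.inl (i, l)) :
        MvPolynomial ((Fin m × Fin q) ⊕ (Fin q × Fin n)) K)) *
      (Matrix.of fun l j => (MvPolynomial.X (Sum.inr (l, j)) :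
        MvPolynomial ((Fin m × Fin q) ⊕ (Fin q × Fin n)) K)) := by
    ext1 i j
    simp [phiAB, Matrix.mul_apply]
  rw [h2] at h
  have h3 := (minorsId_mul_left (q + 1) (Matrix.of fun i l => (MvPolynomial.X (Sum.inl (i, l)) :
        MvPolynomial ((Fin m × Fin q) ⊕ (Fin q × Fin n)) K))
      (Matrix.of fun l j => (MvPolynomial.X (Sum.inr (l, j)) :
        MvPolynomial ((Fin m × Fin q) ⊕ (Fin q × Fin n)) K)))
  rw [minorsId_eq_bot (q + 1) (Nat.lt_succ_self q), ← h] at h3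
  intro f hf
  have := h3 (Ideal.mem_map_of_mem _ hf)
  simpa using this

def cellWt {m n : ℕ} (M : Fin m × Fin n →₀ ℕ) : ℕ :=
  ∑ z : Fin m × Fin n, M z * ((z.1.1 + 1) * (z.2.1 + 1))

lemma cellWt_add {m n : ℕ} (M N : Fin m × Fin n →₀ ℕ) :
    cellWt (M + N) = cellWt M + cellWt N := by
  simp [cellWt, add_mul, Finset.sum_add_distrib]

lemma cellWt_single {m n : ℕ} (z : Fin m × Fin n) :
    cellWt (Finsupp.single z 1) = (z.1.1 + 1) * (z.2.1 + 1) := by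
  classical
  simp [cellWt, Finsupp.single_apply]

lemma cellWt_sum {m n : ℕ} {ι : Type*} (s : Finset ι) (f : ι → Fin m × Fin n) :
    cellWt (∑ i ∈ s, Finsupp.single (f i) 1) =
      ∑ i ∈ s, ((f i).1.1 + 1) * ((f i).2.1 + 1) := by
  classical
  induction s using Finset.induction_on with
  | empty => simp [cellWt]
  | insert a s ha ih => rw [Finset.sum_insert ha, Finset.sum_insert ha, cellWt_add, ih, cellWt_single]

def StdMon {m n : ℕ} (t : ℕ) (M : Fin m × Fin n →₀ ℕ) : Prop :=
  ¬ ∃ (r : Fin t → Fin m) (c : Fin t → Fin n), StrictMono r ∧ StrictMono c ∧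
    ∀ i, M (r i, c i) ≠ 0

lemma perm_eq_one_of_strictMono {t : ℕ} (σ : Equiv.Perm (Fin t)) (h : StrictMono σ) : σ = 1 := by
  have := Subsingleton.elim (h.orderIsoOfSurjective _ σ.surjective) (OrderIso.refl _)
  ext i
  have h2 := congrArg (fun e => (e i : Fin t)) this
  simpa using congrArg Fin.val h2

lemma wt_perm_lt {m n t : ℕ} (r : Fin t → Fin m) (c : Fin t → Fin n) (hr : StrictMono r)
    (hc : StrictMono c) (σ : Equiv.Perm (Fin t)) (hσ : σ ≠ 1) :
    ∑ i, ((r (σ i)).1 + 1) * ((c i).1 + 1) < ∑ i, ((r i).1 + 1) * ((c i).1 + 1) := by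
  have hm : Monovary (fun i => (r i).1 + 1) (fun i => (c i).1 + 1) := by
    intro i j hij
    have : c i < c j := by simpa using hij
    have := hr.monotone (hc.lt_iff_lt.1 this).le
    simpa using this
  refine (hm.sum_comp_perm_mul_lt_sum_mul_iff).2 fun hmon => hσ ?_
  apply perm_eq_one_of_strictMono
  apply Monotone.strictMono_of_injective _ σ.injective
  intro i j hij
  rcases hij.lt_or_eq with h | h
  · have := @hmon i j (by simpa using hc h)
    simp only [Function.comp_apply, add_le_add_iff_right] at this
    exact hr.le_iff_le.1 this
  · rw [h]

lemma prod_X_eq {σ K ι : Type*} [CommSemiring K] (s : Finset ι) (f : ι → σ) :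
    ∏ i ∈ s, (MvPolynomial.X (f i) : MvPolynomial σ K) =
      MvPolynomial.monomial (∑ i ∈ s, Finsupp.single (f i) 1) 1 := by
  classical
  induction s using Finset.induction_on with
  | empty => simp
  | insert a s ha ih =>
    rw [Finset.prod_insert ha, Finset.sum_insert ha, ih, MvPolynomial.X, MvPolynomial.monomial_mul,
      one_mul]

lemma monomial_mem_span {K : Type*} [Field K] {m n t : ℕ} (M : Fin m × Fin n →₀ ℕ) :
    (MvPolynomial.monomial M (1 : K)) ∈ (genericMinors K m n t).restrictScalars K ⊔
      Submodule.span K {p | ∃ N, StdMon t N ∧ p = MvPolynomial.monomial N (1 : K)} := by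
  classical
  induction hw : cellWt M using Nat.strong_induction_on generalizing M with
  | _ w ih =>
  by_cases hM : StdMon t M
  · exact Submodule.mem_sup_right (Submodule.subset_span ⟨M, hM, rfl⟩)
  rw [StdMon, not_not] at hM
  obtain ⟨r, c, hr, hc, hpos⟩ := hM
  set D : Equiv.Perm (Fin t) → (Fin m × Fin n →₀ ℕ) := fun σ =>
    ∑ i, Finsupp.single (r (σ i), c i) 1 with hD
  have hle : D 1 ≤ M := by
    intro z
    simp only [hD, Finsupp.coe_finsetSum, Finset.sum_apply, Equiv.Perm.one_apply]
    by_cases hz : ∃ i, (r i, c i) = z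
    · obtain ⟨i, rfl⟩ := hz
      rw [Finset.sum_eq_single i]
      · simpa using Nat.one_le_iff_ne_zero.2 (hpos i)
      · intro j _ hj
        rw [Finsupp.single_apply, if_neg]
        intro h
        exact hj (hr.injective (Prod.ext_iff.1 h).1)
      · simp
    · rw [Finset.sum_eq_zero]
      · exact Nat.zero_le _
      · intro j _
        rw [Finsupp.single_apply, if_neg]
        intro h
        exact hz ⟨j, h⟩
  obtain ⟨M', rfl⟩ := exists_add_of_le hle
  have hdet : MvPolynomial.monomial M' (1 : K) * Matrix.det (Matrix.of fun i j =>
      (MvPolynomial.X (r i, c j) : MvPolynomial (Fin m × Fin n) K)) =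
      ∑ σ : Equiv.Perm (Fin t), ((Equiv.Perm.sign σ : ℤ) : K) •
        MvPolynomial.monomial (D σ + M') (1 : K) := by
    rw [Matrix.det_apply, Finset.mul_sum]
    refine Finset.sum_congr rfl fun σ _ => ?_
    simp only [Matrix.of_apply]
    rw [prod_X_eq, mul_smul_comm, MvPolynomial.monomial_mul, one_mul, add_comm M']
    rw [Units.smul_def, ← Int.cast_smul_eq_zsmul K]
  have hdetI : MvPolynomial.monomial M' (1 : K) * Matrix.det (Matrix.of fun i j =>
      (MvPolynomial.X (r i, c j) : MvPolynomial (Fin m × Fin n) K)) ∈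
      (genericMinors K m n t).restrictScalars K := by
    apply Ideal.mul_mem_left
    exact Ideal.subset_span ⟨r, c, hr.injective, hc.injective, rfl⟩
  rw [← Finset.add_sum_erase _ _ (Finset.mem_univ 1)] at hdet
  have h1 : MvPolynomial.monomial (D 1 + M') (1 : K) =
      MvPolynomial.monomial M' (1 : K) * Matrix.det (Matrix.of fun i j =>
      (MvPolynomial.X (r i, c j) : MvPolynomial (Fin m × Fin n) K)) -
      ∑ σ ∈ Finset.univ.erase (1 : Equiv.Perm (Fin t)), ((Equiv.Perm.sign σ : ℤ) : K) •
        MvPolynomial.monomial (D σ + M') (1 : K) := by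
    rw [hdet]; simp
  rw [h1]
  refine Submodule.sub_mem _ (Submodule.mem_sup_left hdetI) (Submodule.sum_mem _ fun σ hσ => ?_)
  refine Submodule.smul_mem _ _ (ih (cellWt (D σ + M')) ?_ _ rfl)
  rw [← hw, cellWt_add, cellWt_add]
  have := wt_perm_lt r c hr hc σ (Finset.ne_of_mem_erase hσ)
  have e1 : cellWt (D σ) = ∑ i, ((r (σ i)).1 + 1) * ((c i).1 + 1) := cellWt_sum _ _
  have e2 : cellWt (D 1) = ∑ i, ((r i).1 + 1) * ((c i).1 + 1) := cellWt_sum _ _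
  omega

lemma exists_std_rep {K : Type*} [Field K] {m n t : ℕ} (f : MvPolynomial (Fin m × Fin n) K) :
    ∃ g ∈ genericMinors K m n t, ∀ M ∈ (f - g).support, StdMon t M := by
  have h : f ∈ (genericMinors K m n t).restrictScalars K ⊔
      Submodule.span K {p | ∃ N, StdMon t N ∧ p = MvPolynomial.monomial N (1 : K)} := by
    rw [f.as_sum]
    refine Submodule.sum_mem _ fun M _ => ?_
    have := Submodule.smul_mem _ (f.coeff M) (monomial_mem_span (K := K) (t := t) M)
    rwa [MvPolynomial.smul_monomial, smul_eq_mul, mul_one] at this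
  obtain ⟨g, hg, p, hp, rfl⟩ := Submodule.mem_sup.1 h
  refine ⟨g, hg, ?_⟩
  rw [add_sub_cancel_left]
  clear h
  classical
  induction hp using Submodule.span_induction with
  | mem x hx =>
    obtain ⟨N, hN, rfl⟩ := hx
    intro M hM
    have := MvPolynomial.support_monomial_subset hM
    rw [Finset.mem_singleton] at this
    rwa [this]
  | zero => simp
  | add x y _ _ hx hy =>
    intro M hM
    rcases Finset.mem_union.1 (MvPolynomial.support_add hM) with h | h
    · exact hx M h
    · exact hy M h
  | smul a x _ hx =>
    intro M hM
    exact hx M (MvPolynomial.support_smul hM)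

lemma exists_coloring {m n : ℕ} (q : ℕ) (S : Finset (Fin m × Fin n))
    (hS : ¬ ∃ (r : Fin (q + 1) → Fin m) (c : Fin (q + 1) → Fin n), StrictMono r ∧ StrictMono c ∧
      ∀ i, (r i, c i) ∈ S) :
    ∃ col : Fin m × Fin n → ℕ, (∀ z ∈ S, col z < q) ∧
      ∀ z ∈ S, ∀ z' ∈ S, z.1 < z'.1 → z.2 < z'.2 → col z ≠ col z' := by
  classical
  induction q generalizing S with
  | zero =>
    have : S = ∅ := by
      rw [Finset.eq_empty_iff_forall_notMem]
      intro z hz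
      exact hS ⟨fun _ => z.1, fun _ => z.2, fun i j h => absurd h (by omega), fun i j h => absurd h (by omega),
        fun _ => hz⟩
    subst this
    exact ⟨fun _ => 0, by simp, by simp⟩
  | succ q ih =>
    set S' := S.filter fun z => ∃ z0 ∈ S, z0.1 < z.1 ∧ z0.2 < z.2 with hS'
    obtain ⟨col, h1, h2⟩ := ih S' (by
      rintro ⟨r, c, hr, hc, hrc⟩
      obtain ⟨z0, hz0, ha, hb⟩ := (Finset.mem_filter.1 (hrc 0)).2
      refine hS ⟨Fin.cons z0.1 r, Fin.cons z0.2 c, ?_, ?_, ?_⟩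
      · rw [Fin.strictMono_iff_lt_succ]
        intro i
        refine Fin.cases ?_ (fun j => ?_) i
        · simpa using ha
        · simp only [← Fin.succ_castSucc, Fin.cons_succ]
          exact hr (Fin.castSucc_lt_succ)
      · rw [Fin.strictMono_iff_lt_succ]
        intro i
        refine Fin.cases ?_ (fun j => ?_) i
        · simpa using hb
        · simp only [← Fin.succ_castSucc, Fin.cons_succ]
          exact hc (Fin.castSucc_lt_succ)
      · intro i
        refine Fin.cases ?_ (fun j => ?_) i
        · simpa using hz0
        · simpa using (Finset.mem_filter.1 (hrc j)).1)
    refine ⟨fun z => if z ∈ S' then col z + 1 else 0, ?_, ?_⟩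
    · intro z hz
      dsimp only
      split_ifs with h
      · exact Nat.succ_lt_succ (h1 z h)
      · exact Nat.succ_pos _
    · intro z hz z' hz' hlt hlt'
      have hz'S : z' ∈ S' := Finset.mem_filter.2 ⟨hz', z, hz, hlt, hlt'⟩
      dsimp only
      rw [if_pos hz'S]
      split_ifs with h
      · have := h2 z h z' hz'S hlt hlt'
        omega
      · omega

lemma cum_le {m n : ℕ} (N N0 : Fin m × Fin n → ℕ)
    (hrow : ∀ i, ∑ j, N (i, j) = ∑ j, N0 (i, j)) (hcol : ∀ j, ∑ i, N (i, j) = ∑ i, N0 (i, j))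
    (hanti : ∀ z z', N0 z ≠ 0 → N0 z' ≠ 0 → z.1 < z'.1 → z.2 < z'.2 → False)
    (p : Fin m) (p' : Fin n) :
    ∑ z, (if p ≤ z.1 ∧ p' ≤ z.2 then N0 z else 0) ≤
      ∑ z, (if p ≤ z.1 ∧ p' ≤ z.2 then N z else 0) := by
  by_cases h0 : ∃ z, (p ≤ z.1 ∧ p' ≤ z.2) ∧ N0 z ≠ 0
  · obtain ⟨z0, ⟨hz1, hz2⟩, hz0⟩ := h0
    have hid : ∀ F : Fin m × Fin n → ℕ,
        ∑ z, (if p ≤ z.1 ∧ p' ≤ z.2 then F z else 0) + ∑ z, F z =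
        ∑ z, (if p ≤ z.1 then F z else 0) + ∑ z, (if p' ≤ z.2 then F z else 0) +
          ∑ z, (if z.1 < p ∧ z.2 < p' then F z else 0) := by
      intro F
      rw [← Finset.sum_add_distrib, ← Finset.sum_add_distrib, ← Finset.sum_add_distrib]
      refine Finset.sum_congr rfl fun z _ => ?_
      by_cases h1 : p ≤ z.1 <;> by_cases h2 : p' ≤ z.2 <;>
        simp [h1, h2, not_lt.2, not_le.1]
    have hR : ∑ z, (if p ≤ z.1 then N z else 0) = ∑ z, (if p ≤ z.1 then N0 z else 0) := by
      rw [Fintype.sum_prod_type, Fintype.sum_prod_type]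
      refine Finset.sum_congr rfl fun i _ => ?_
      by_cases h : p ≤ i
      · simp [h, hrow]
      · simp [h]
    have hC : ∑ z, (if p' ≤ z.2 then N z else 0) = ∑ z, (if p' ≤ z.2 then N0 z else 0) := by
      rw [Fintype.sum_prod_type_right, Fintype.sum_prod_type_right]
      refine Finset.sum_congr rfl fun i _ => ?_
      by_cases h : p' ≤ i
      · simp [h, hcol]
      · simp [h]
    have hT : ∑ z, N z = ∑ z, N0 z := by
      rw [Fintype.sum_prod_type, Fintype.sum_prod_type]
      exact Finset.sum_congr rfl fun i _ => hrow i
    have hZ : ∑ z : Fin m × Fin n, (if z.1 < p ∧ z.2 < p' then N0 z else 0) = 0 := by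
      refine Finset.sum_eq_zero fun z _ => ?_
      split_ifs with h
      · by_contra hne
        exact hanti z z0 hne hz0 (h.1.trans_le hz1) (h.2.trans_le hz2)
      · rfl
    have a := hid N
    have b := hid N0
    omega
  · push Not at h0
    rw [Finset.sum_eq_zero]
    · exact Nat.zero_le _
    · intro z _
      split_ifs with h
      · exact h0 z h
      · rfl

lemma sum_wt_eq {m n : ℕ} (F : Fin m × Fin n → ℕ) :
    ∑ z : Fin m × Fin n, F z * ((z.1.1 + 1) * (z.2.1 + 1)) =
      ∑ p : Fin m × Fin n, ∑ z, (if p.1 ≤ z.1 ∧ p.2 ≤ z.2 then F z else 0) := by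
  rw [Finset.sum_comm]
  refine Finset.sum_congr rfl fun z _ => ?_
  rw [← Finset.sum_filter, Finset.sum_const, smul_eq_mul, mul_comm]
  congr 1
  have : (Finset.univ.filter fun p : Fin m × Fin n => p.1 ≤ z.1 ∧ p.2 ≤ z.2) =
      Finset.Iic z.1 ×ˢ Finset.Iic z.2 := by
    ext p; simp
  rw [this, Finset.card_product, Fin.card_Iic, Fin.card_Iic]

lemma eq_of_cum_eq {m n : ℕ} (N N0 : Fin m × Fin n → ℕ)
    (h : ∀ p : Fin m × Fin n, ∑ z, (if p.1 ≤ z.1 ∧ p.2 ≤ z.2 then N0 z else 0) =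
      ∑ z, (if p.1 ≤ z.1 ∧ p.2 ≤ z.2 then N z else 0)) : N = N0 := by
  by_contra hne
  have : (Finset.univ.filter fun z => N z ≠ N0 z).Nonempty := by
    obtain ⟨z, hz⟩ := Function.ne_iff.1 hne
    exact ⟨z, by simpa using hz⟩
  obtain ⟨z, hz, hmax⟩ := Finset.exists_max_image _ (fun z : Fin m × Fin n => z.1.1 + z.2.1) this
  have hz' : N z ≠ N0 z := by simpa using hz
  have h1 := h z
  rw [← Finset.add_sum_erase _ _ (Finset.mem_univ z),
    ← Finset.add_sum_erase _ _ (Finset.mem_univ z)] at h1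
  have h2 : ∑ x ∈ Finset.univ.erase z, (if z.1 ≤ x.1 ∧ z.2 ≤ x.2 then N0 x else 0) =
      ∑ x ∈ Finset.univ.erase z, (if z.1 ≤ x.1 ∧ z.2 ≤ x.2 then N x else 0) := by
    refine Finset.sum_congr rfl fun x hx => ?_
    split_ifs with hc
    · by_contra hb
      have := hmax x (by simpa using fun h => hb h.symm)
      have hxz := Finset.ne_of_mem_erase hx
      apply hxz
      have h3 : z.1.1 ≤ x.1.1 := hc.1
      have h4 : z.2.1 ≤ x.2.1 := hc.2
      ext <;> omega
    · rfl
  rw [h2] at h1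
  simp at h1
  exact hz' h1.symm

/-- marginals -/
lemma color_unique {m n q : ℕ} (N N0 : (Fin m × Fin n) × Fin q →₀ ℕ)
    (hrow : ∀ l i, ∑ j, N ((i, j), l) = ∑ j, N0 ((i, j), l))
    (hcol : ∀ l j, ∑ i, N ((i, j), l) = ∑ i, N0 ((i, j), l))
    (hanti : ∀ l z z', N0 (z, l) ≠ 0 → N0 (z', l) ≠ 0 → z.1 < z'.1 → z.2 < z'.2 → False)
    (hw : ∑ z : Fin m × Fin n, (∑ l, N (z, l)) * ((z.1.1 + 1) * (z.2.1 + 1)) ≤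
      ∑ z : Fin m × Fin n, (∑ l, N0 (z, l)) * ((z.1.1 + 1) * (z.2.1 + 1))) : N = N0 := by
  have e : ∀ N : (Fin m × Fin n) × Fin q →₀ ℕ,
      ∑ z : Fin m × Fin n, (∑ l, N (z, l)) * ((z.1.1 + 1) * (z.2.1 + 1)) =
      ∑ x : Fin q × (Fin m × Fin n),
        ∑ z, (if x.2.1 ≤ z.1 ∧ x.2.2 ≤ z.2 then N (z, x.1) else 0) := by
    intro N
    simp_rw [Finset.sum_mul]
    rw [Finset.sum_comm, Fintype.sum_prod_type]
    refine Finset.sum_congr rfl fun l _ => ?_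
    exact sum_wt_eq fun z => N (z, l)
  rw [e, e] at hw
  have hle : ∀ x ∈ (Finset.univ : Finset (Fin q × (Fin m × Fin n))),
      ∑ z, (if x.2.1 ≤ z.1 ∧ x.2.2 ≤ z.2 then N0 (z, x.1) else 0) ≤
      ∑ z, (if x.2.1 ≤ z.1 ∧ x.2.2 ≤ z.2 then N (z, x.1) else 0) := fun x _ =>
    cum_le (fun z => N (z, x.1)) (fun z => N0 (z, x.1)) (hrow x.1) (hcol x.1) (hanti x.1) _ _
  have heq := (Finset.sum_eq_sum_iff_of_le hle).1 (le_antisymm (Finset.sum_le_sum hle) hw)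
  ext ⟨z, l⟩
  have := eq_of_cum_eq (fun z => N (z, l)) (fun z => N0 (z, l))
    (fun p => heq (l, p) (Finset.mem_univ _))
  exact congrFun this z

noncomputable def phiOne (K : Type*) [Field K] (m n q : ℕ) :
    MvPolynomial (Fin m × Fin n) K →ₐ[K] MvPolynomial ((Fin m × Fin n) × Fin q) K :=
  MvPolynomial.aeval fun z => ∑ l : Fin q, MvPolynomial.X (z, l)

noncomputable def cellW (m n q : ℕ) : (Fin m × Fin n) × Fin q → (Fin m × Fin n →₀ ℕ) :=
  fun x => Finsupp.single x.1 1

noncomputable def abW (m n q : ℕ) :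
    (Fin m × Fin n) × Fin q → (((Fin m × Fin q) ⊕ (Fin q × Fin n)) →₀ ℕ) :=
  fun x => Finsupp.single (Sum.inl (x.1.1, x.2)) 1 + Finsupp.single (Sum.inr (x.2, x.1.2)) 1

lemma weight_apply_fintype {σ τ : Type*} [Fintype σ] (w : σ → (τ →₀ ℕ)) (N : σ →₀ ℕ) (z : τ) :
    Finsupp.weight w N z = ∑ x, N x * w x z := by
  rw [Finsupp.weight_apply, Finsupp.sum_fintype _ _ (by simp)]
  simp [Finsupp.coe_finsetSum]

lemma weight_cellW {m n q : ℕ} (N : (Fin m × Fin n) × Fin q →₀ ℕ) (z : Fin m × Fin n) :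
    Finsupp.weight (cellW m n q) N z = ∑ l, N (z, l) := by
  classical
  rw [weight_apply_fintype, Fintype.sum_prod_type]
  simp [cellW, Finsupp.single_apply]

lemma weight_abW_inl {m n q : ℕ} (N : (Fin m × Fin n) × Fin q →₀ ℕ) (i : Fin m) (l : Fin q) :
    Finsupp.weight (abW m n q) N (Sum.inl (i, l)) = ∑ j, N ((i, j), l) := by
  classical
  rw [weight_apply_fintype, Fintype.sum_prod_type, Fintype.sum_prod_type,
    Finset.sum_eq_single i]
  · refine Finset.sum_congr rfl fun j _ => ?_
    rw [Finset.sum_eq_single l]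
    · simp [abW]
    · intro l' _ h; simp [abW, h]
    · simp
  · intro i' _ h; simp [abW, h]
  · simp

lemma weight_abW_inr {m n q : ℕ} (N : (Fin m × Fin n) × Fin q →₀ ℕ) (j : Fin n) (l : Fin q) :
    Finsupp.weight (abW m n q) N (Sum.inr (l, j)) = ∑ i, N ((i, j), l) := by
  classical
  rw [weight_apply_fintype, Fintype.sum_prod_type, Fintype.sum_prod_type_right,
    Finset.sum_eq_single j]
  · refine Finset.sum_congr rfl fun i _ => ?_
    rw [Finset.sum_eq_single l]
    · simp [abW]
    · intro l' _ h; simp [abW, h]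
    · simp
  · intro i' _ h; simp [abW, h]
  · simp

lemma aeval_monomial_family {σ τ K : Type*} [Field K] (v : σ → (τ →₀ ℕ)) (N : σ →₀ ℕ) (a : K) :
    MvPolynomial.aeval (fun x => (MvPolynomial.monomial (v x) (1 : K))) (MvPolynomial.monomial N a)
      = MvPolynomial.monomial (Finsupp.weight v N) a := by
  rw [MvPolynomial.aeval_monomial, Finsupp.weight_apply]
  induction N using Finsupp.induction with
  | zero => simp [MvPolynomial.algebraMap_eq]
  | single_add x b N hx hb ih =>
    classical
    rw [Finsupp.prod_add_index_of_disjoint, Finsupp.sum_add_index_of_disjoint]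
    · rw [mul_left_comm, ih, Finsupp.prod_single_index (by simp),
        Finsupp.sum_single_index (by simp), MvPolynomial.monomial_pow, MvPolynomial.monomial_mul]
      simp
    all_goals
      rw [Finsupp.support_single _ hb]
      simpa using hx

lemma exists_other {σ τ K : Type*} [Field K] (v : σ → (τ →₀ ℕ)) (G : MvPolynomial σ K)
    (hG : MvPolynomial.aeval (fun x => (MvPolynomial.monomial (v x) (1 : K))) G = 0)
    (N0 : σ →₀ ℕ) (hN0 : N0 ∈ G.support) :
    ∃ N ∈ G.support, N ≠ N0 ∧ Finsupp.weight v N = Finsupp.weight v N0 := by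
  classical
  by_contra hcon
  push Not at hcon
  have h := congrArg (MvPolynomial.coeff (Finsupp.weight v N0)) hG
  rw [G.as_sum, map_sum, MvPolynomial.coeff_sum, MvPolynomial.coeff_zero,
    Finset.sum_eq_single N0] at h
  · rw [aeval_monomial_family, MvPolynomial.coeff_monomial, if_pos rfl] at h
    exact MvPolynomial.mem_support_iff.1 hN0 h
  · intro N hN hne
    rw [aeval_monomial_family, MvPolynomial.coeff_monomial, if_neg (hcon N hN hne)]
  · exact fun h => absurd hN0 h

lemma phiOne_support {K : Type*} [Field K] {m n q : ℕ} (f : MvPolynomial (Fin m × Fin n) K)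
    (N : (Fin m × Fin n) × Fin q →₀ ℕ) (hN : N ∈ (phiOne K m n q f).support) :
    Finsupp.weight (cellW m n q) N ∈ f.support := by
  classical
  rw [MvPolynomial.mem_support_iff, f.as_sum, map_sum, MvPolynomial.coeff_sum] at hN
  obtain ⟨M, hM, hne⟩ := Finset.exists_ne_zero_of_sum_ne_zero hN
  have hh : MvPolynomial.IsWeightedHomogeneous (cellW m n q)
      (phiOne K m n q (MvPolynomial.monomial M (f.coeff M))) M := by
    rw [phiOne, MvPolynomial.aeval_monomial]
    have h1 : MvPolynomial.IsWeightedHomogeneous (cellW m n q)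
      (M.prod fun i k => (∑ l : Fin q, (MvPolynomial.X (i, l) :
        MvPolynomial ((Fin m × Fin n) × Fin q) K)) ^ k) (∑ i ∈ M.support, M i • Finsupp.single i 1) := by
      apply MvPolynomial.IsWeightedHomogeneous.prod
      intro i _
      apply MvPolynomial.IsWeightedHomogeneous.pow
      apply MvPolynomial.IsWeightedHomogeneous.sum
      intro l _
      exact MvPolynomial.isWeightedHomogeneous_X K (cellW m n q) (i, l)
    have h2 : (∑ i ∈ M.support, M i • Finsupp.single i 1) = M := by
      conv_rhs => rw [← Finsupp.sum_single M]
      simp [Finsupp.sum]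
    rw [h2] at h1
    have h3 := (MvPolynomial.isWeightedHomogeneous_C (cellW m n q) (f.coeff M)).mul h1
    rwa [zero_add] at h3
  rw [hh hne]
  exact hM

lemma phiAB_eq (K : Type*) [Field K] (m n q : ℕ) :
    phiAB K m n q = (MvPolynomial.aeval
      (fun x => (MvPolynomial.monomial (abW m n q x) (1 : K)))).comp (phiOne K m n q) := by
  apply MvPolynomial.algHom_ext
  intro z
  rw [AlgHom.comp_apply, phiAB, phiOne, MvPolynomial.aeval_X, MvPolynomial.aeval_X, map_sum]
  refine Finset.sum_congr rfl fun l _ => ?_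
  rw [MvPolynomial.aeval_X, abW, MvPolynomial.X, MvPolynomial.X, MvPolynomial.monomial_mul, one_mul]

lemma mem_support_lift {K : Type*} [Field K] {m n q : ℕ} (f : MvPolynomial (Fin m × Fin n) K)
    (col : Fin m × Fin n → Fin q) (M : Fin m × Fin n →₀ ℕ) (hM : M ∈ f.support) :
    ∃ N ∈ (phiOne K m n q f).support, (∀ z l, N (z, l) = if l = col z then M z else 0) := by
  classical
  let kap : MvPolynomial ((Fin m × Fin n) × Fin q) K →ₐ[K] MvPolynomial (Fin m × Fin n) K :=
    MvPolynomial.aeval fun x => if x.2 = col x.1 then MvPolynomial.X x.1 else 0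
  have hk : kap (phiOne K m n q f) = f := by
    have : kap.comp (phiOne K m n q) = AlgHom.id K _ := by
      apply MvPolynomial.algHom_ext
      intro z
      simp [kap, phiOne]
    exact congrArg (fun F => F f) this
  have hc : (kap (phiOne K m n q f)).coeff M ≠ 0 := by
    rw [hk]; exact MvPolynomial.mem_support_iff.1 hM
  rw [(phiOne K m n q f).as_sum, map_sum, MvPolynomial.coeff_sum] at hc
  obtain ⟨N, hN, hne⟩ := Finset.exists_ne_zero_of_sum_ne_zero hc
  refine ⟨N, hN, ?_⟩
  set a := (phiOne K m n q f).coeff N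
  have hsupp : ∀ x, N x ≠ 0 → x.2 = col x.1 := by
    intro x hx
    by_contra hxc
    apply hne
    rw [MvPolynomial.aeval_monomial, Finsupp.prod, Finset.prod_eq_zero (i := x)]
    · simp
    · simpa using hx
    · simp [hxc, hx]
  have hmon : kap (MvPolynomial.monomial N a) =
      MvPolynomial.monomial (Finsupp.weight (cellW m n q) N) a := by
    rw [← aeval_monomial_family, MvPolynomial.aeval_monomial, MvPolynomial.aeval_monomial]
    congr 1
    refine Finset.prod_congr rfl fun x hx => ?_
    simp [hsupp x (by simpa using hx), cellW, MvPolynomial.X]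
  rw [hmon, MvPolynomial.coeff_monomial] at hne
  have hw : Finsupp.weight (cellW m n q) N = M := by
    by_contra h
    simp [h] at hne
  intro z l
  split_ifs with h
  · rw [← hw, weight_cellW, Finset.sum_eq_single l]
    · intro l' _ hl'
      by_contra h0
      exact hl' ((hsupp _ h0).trans h.symm)
    · simp
  · by_contra h0
    exact h (hsupp _ h0)

lemma eq_zero_of_std {K : Type*} [Field K] {m n q : ℕ} (f : MvPolynomial (Fin m × Fin n) K)
    (hstd : ∀ M ∈ f.support, StdMon (q + 1) M) (hf : phiAB K m n q f = 0) : f = 0 := by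
  classical
  by_contra hne
  obtain ⟨M, hM, hmax⟩ := Finset.exists_max_image f.support cellWt
    (MvPolynomial.support_nonempty.2 hne)
  obtain ⟨col0, hc1, hc2⟩ := exists_coloring q M.support (by
    have := hstd M hM
    simpa [StdMon] using this)
  rcases Nat.eq_zero_or_pos q with hq | hq
  · subst hq
    have hz : ∀ N ∈ f.support, N = 0 := by
      intro N hN
      ext z
      by_contra h
      exact hstd N hN ⟨fun _ => z.1, fun _ => z.2, fun i j h => absurd h (by omega),
        fun i j h => absurd h (by omega), fun _ => h⟩
    have hC : f = MvPolynomial.C (f.coeff 0) := by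
      ext N
      rw [MvPolynomial.coeff_C]
      split_ifs with h
      · rw [h]
      · by_contra h2
        exact h (hz N (MvPolynomial.mem_support_iff.2 h2)).symm
    rw [hC, ← MvPolynomial.algebraMap_eq, AlgHom.commutes, MvPolynomial.algebraMap_eq] at hf
    rw [hC, MvPolynomial.C_eq_zero.1 hf] at hne
    simp at hne
  · let col : Fin m × Fin n → Fin q := fun z => if h : col0 z < q then ⟨col0 z, h⟩ else ⟨0, hq⟩
    have hcol : ∀ z ∈ M.support, ∀ z' ∈ M.support, z.1 < z'.1 → z.2 < z'.2 → col z ≠ col z' := by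
      intro z hz z' hz' h1 h2 h3
      apply hc2 z hz z' hz' h1 h2
      simpa [col, hc1 z hz, hc1 z' hz'] using h3
    obtain ⟨N0, hN0, hN0c⟩ := mem_support_lift f col M hM
    rw [phiAB_eq, AlgHom.comp_apply] at hf
    obtain ⟨N, hN, hNne, hNw⟩ := exists_other _ _ hf N0 hN0
    apply hNne
    apply color_unique
    · intro l i
      rw [← weight_abW_inl, hNw, weight_abW_inl]
    · intro l j
      rw [← weight_abW_inr, hNw, weight_abW_inr]
    · intro l z z' h h' h1 h2
      rw [hN0c] at h h'
      have e1 : l = col z := by by_contra hh; simp [hh] at h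
      have e2 : l = col z' := by by_contra hh; simp [hh] at h'
      rw [if_pos e1] at h
      rw [if_pos e2] at h'
      exact hcol z (by simpa using h) z' (by simpa using h') h1 h2 (e1.symm.trans e2)
    · have h1 := hmax _ (phiOne_support f N hN)
      simp only [cellWt, weight_cellW] at h1
      refine h1.trans (le_of_eq ?_)
      refine Finset.sum_congr rfl fun z _ => ?_
      simp [hN0c]

lemma genericMinors_eq_ker (K : Type*) [Field K] (m n q : ℕ) :
    genericMinors K m n (q + 1) = RingHom.ker (phiAB K m n q) := by
  apply le_antisymm (genericMinors_le_ker K m n q)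
  intro f hf
  obtain ⟨g, hg, hstd⟩ := exists_std_rep (t := q + 1) f
  have h0 : f - g = 0 := by
    apply eq_zero_of_std (q := q) _ hstd
    rw [map_sub, (RingHom.mem_ker).1 hf, (RingHom.mem_ker).1 (genericMinors_le_ker K m n q hg), sub_zero]
  rw [sub_eq_zero.1 h0]
  exact hg

lemma genericMinors_isPrime (K : Type*) [Field K] (m n q : ℕ) :
    (genericMinors K m n (q + 1)).IsPrime := by
  rw [genericMinors_eq_ker]
  exact RingHom.ker_isPrime _

lemma mem_symbolicPower_iff {R : Type*} [CommRing R] [IsNoetherianRing R] (I : Ideal R)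
    (hI : I.IsPrime) (s : ℕ) (f : R) :
    f ∈ symbolicPower I s ↔ ∃ h, h ∉ I ∧ h * f ∈ I ^ s := by
  have hass : associatedPrimes R (R ⧸ I) = {I} := by
    rw [associatedPrimes.eq_singleton_of_isPrimary hI.isPrimary, hI.radical]
  have key : ∀ (p : Ideal R) (hp : p.IsPrime), f ∈ Ideal.comap
      (algebraMap R (Localization.AtPrime p))
      (Ideal.map (algebraMap R (Localization.AtPrime p)) (I ^ s)) ↔ ∃ h, h ∉ p ∧ h * f ∈ I ^ s := by
    intro p hp
    rw [Ideal.mem_comap, IsLocalization.algebraMap_mem_map_algebraMap_iff p.primeCompl]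
    rfl
  rw [symbolicPower, Ideal.mem_iInf]
  constructor
  · intro h
    exact (key I hI).1 (h ⟨I, by rw [hass]; rfl⟩)
  · rintro h ⟨p, hp⟩
    have hpI : p = I := by rw [hass] at hp; exact hp
    subst hpI
    exact (key p hI).2 h

lemma block_det_identity {R : Type*} [CommRing R] (q p : ℕ) (A : Matrix (Fin q) (Fin q) R)
    (B : Matrix (Fin q) (Fin p) R) (C : Matrix (Fin p) (Fin q) R) (D : Matrix (Fin p) (Fin p) R) :
    A.det ^ (q + p) * (Matrix.fromBlocks A B C D).det =
      A.det ^ (q + 1) * (A.det • D - C * A.adjugate * B).det := by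
  have h : Matrix.fromBlocks A.adjugate 0 (-(C * A.adjugate)) (A.det • (1 : Matrix (Fin p) (Fin p) R)) *
      Matrix.fromBlocks A B C D =
      Matrix.fromBlocks (A.det • (1 : Matrix (Fin q) (Fin q) R)) (A.adjugate * B) 0
        (A.det • D - C * A.adjugate * B) := by
    rw [Matrix.fromBlocks_multiply]
    congr 1
    · simp [Matrix.adjugate_mul]
    · simp
    · simp [Matrix.mul_assoc, Matrix.adjugate_mul]
    · simp [sub_eq_neg_add]
  have h2 := congrArg Matrix.det h
  rw [Matrix.det_mul, Matrix.det_fromBlocks_zero₁₂, Matrix.det_fromBlocks_zero₂₁,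
    Matrix.det_smul, Matrix.det_smul, Matrix.det_one, Matrix.det_one, Fintype.card_fin,
    Fintype.card_fin, mul_one, mul_one] at h2
  have h3 : A.det * A.adjugate.det = A.det ^ q := by
    rw [← Matrix.det_mul, Matrix.mul_adjugate, Matrix.det_smul, Matrix.det_one, Fintype.card_fin,
      mul_one]
  linear_combination A.det * h2 - (A.det ^ p * (Matrix.fromBlocks A B C D).det) * h3

lemma det_mem_pow {R : Type*} [CommRing R] (I : Ideal R) (p : ℕ) (E : Matrix (Fin p) (Fin p) R)
    (hE : ∀ i j, E i j ∈ I) : E.det ∈ I ^ p := by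
  rw [Matrix.det_apply]
  refine Ideal.sum_mem _ fun σ _ => ?_
  rw [Units.smul_def]
  apply zsmul_mem
  have := Ideal.prod_mem_prod (s := Finset.univ) (I := fun _ : Fin p => I)
    (x := fun i => E (σ i) i) (fun i _ => hE _ _)
  simpa using this

noncomputable def maxMinor (K : Type*) [Field K] (m n : ℕ) (hmn : m ≤ n) :
    MvPolynomial (Fin m × Fin n) K :=
  Matrix.det (Matrix.of fun i j : Fin m => MvPolynomial.X (i, Fin.castLE hmn j))

lemma topMinor_not_mem (K : Type*) [Field K] (p n q : ℕ) (hmn : q + p ≤ n) :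
    Matrix.det (Matrix.of fun i j : Fin q => (MvPolynomial.X (Fin.castAdd p i,
      Fin.castLE hmn (Fin.castAdd p j)) : MvPolynomial (Fin (q + p) × Fin n) K)) ∉
      genericMinors K (q + p) n (q + 1) := by
  classical
  rw [genericMinors_eq_ker, RingHom.mem_ker]
  intro h
  let ψ : MvPolynomial ((Fin (q + p) × Fin q) ⊕ (Fin q × Fin n)) K →ₐ[K] K :=
    MvPolynomial.aeval (Sum.elim (fun x => if x.1.1 = x.2.1 then 1 else 0)
      (fun x => if x.1.1 = x.2.1 then 1 else 0))
  have h2 := congrArg ψ h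
  rw [map_zero, ← AlgHom.comp_apply, AlgHom.map_det] at h2
  have h3 : (ψ.comp (phiAB K (q + p) n q)).mapMatrix (Matrix.of fun i j : Fin q =>
      (MvPolynomial.X (Fin.castAdd p i,
      Fin.castLE hmn (Fin.castAdd p j)) : MvPolynomial (Fin (q + p) × Fin n) K)) = 1 := by
    ext i j
    simp [ψ, phiAB, Matrix.one_apply, Fin.val_inj]
  rw [h3, Matrix.det_one] at h2
  exact one_ne_zero h2

lemma maxMinor_mul_mem (K : Type*) [Field K] (p n q : ℕ) (hmn : q + p ≤ n) :
    ∃ h, h ∉ genericMinors K (q + p) n (q + 1) ∧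
      h * maxMinor K (q + p) n hmn ∈ genericMinors K (q + p) n (q + 1) ^ p := by
  have hprime := genericMinors_isPrime K (q + p) n q
  set I := genericMinors K (q + p) n (q + 1) with hI
  let cc : Fin (q + p) → Fin n := Fin.castLE hmn
  let x : Fin (q + p) → Fin (q + p) → MvPolynomial (Fin (q + p) × Fin n) K :=
    fun i j => MvPolynomial.X (i, cc j)
  let A : Matrix (Fin q) (Fin q) (MvPolynomial (Fin (q + p) × Fin n) K) :=
    Matrix.of fun i j => x (Fin.castAdd p i) (Fin.castAdd p j)
  let B : Matrix (Fin q) (Fin p) (MvPolynomial (Fin (q + p) × Fin n) K) :=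
    Matrix.of fun i j => x (Fin.castAdd p i) (Fin.natAdd q j)
  let C : Matrix (Fin p) (Fin q) (MvPolynomial (Fin (q + p) × Fin n) K) :=
    Matrix.of fun i j => x (Fin.natAdd q i) (Fin.castAdd p j)
  let D : Matrix (Fin p) (Fin p) (MvPolynomial (Fin (q + p) × Fin n) K) :=
    Matrix.of fun i j => x (Fin.natAdd q i) (Fin.natAdd q j)
  have hδ : A.det ∉ I := topMinor_not_mem K p n q hmn
  have hpow : ∀ e : ℕ, A.det ^ e ∉ I := fun e he => hδ (hprime.mem_of_pow_mem _ he)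
  have hΔ : maxMinor K (q + p) n hmn = (Matrix.fromBlocks A B C D).det := by
    rw [maxMinor, ← Matrix.det_submatrix_equiv_self finSumFinEquiv]
    congr 1
    ext (i | i) (j | j) <;> rfl
  refine ⟨A.det ^ (q + p), hpow _, ?_⟩
  rw [hΔ, block_det_identity]
  apply Ideal.mul_mem_left
  apply det_mem_pow
  intro i j
  have hb := block_det_identity q 1 A (B.submatrix id fun _ => j) (C.submatrix (fun _ => i) id)
    (D.submatrix (fun _ => i) fun _ => j)
  have hE : (A.det • D.submatrix (fun _ : Fin 1 => i) (fun _ : Fin 1 => j) -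
      C.submatrix (fun _ : Fin 1 => i) id * A.adjugate * B.submatrix id fun _ : Fin 1 => j).det =
      (A.det • D - C * A.adjugate * B) i j := by
    rw [Matrix.det_fin_one]
    simp [Matrix.mul_apply]
  rw [hE] at hb
  have hmem : (Matrix.fromBlocks A (B.submatrix id fun _ : Fin 1 => j)
      (C.submatrix (fun _ : Fin 1 => i) id) (D.submatrix (fun _ => i) fun _ => j)).det ∈ I := by
    rw [hI, genericMinors_eq]
    apply Ideal.subset_span
    refine ⟨fun k => Sum.elim (Fin.castAdd p) (fun _ => Fin.natAdd q i) (finSumFinEquiv.symm k),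
      fun k => cc (Sum.elim (Fin.castAdd p) (fun _ => Fin.natAdd q j) (finSumFinEquiv.symm k)), ?_⟩
    rw [← Matrix.det_submatrix_equiv_self (finSumFinEquiv (m := q) (n := 1)).symm]
    congr 1
    ext1 a b
    simp only [Matrix.submatrix_apply, Matrix.of_apply]
    generalize finSumFinEquiv.symm a = a'
    generalize finSumFinEquiv.symm b = b'
    rcases a' with a' | a' <;> rcases b' with b' | b' <;> rfl
  have := Ideal.mul_mem_left I (A.det ^ (q + 1)) hmem
  rw [hb] at this
  exact (hprime.mem_or_mem this).resolve_left (hpow _)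

lemma maxMinor_pow_mem (K : Type*) [Field K] (p n q : ℕ) (hmn : q + p ≤ n) (k s : ℕ)
    (hs : s ≤ p * k) :
    maxMinor K (q + p) n hmn ^ k ∈ symbolicPower (genericMinors K (q + p) n (q + 1)) s := by
  have hprime := genericMinors_isPrime K (q + p) n q
  rw [mem_symbolicPower_iff _ hprime]
  obtain ⟨h, h1, h2⟩ := maxMinor_mul_mem K p n q hmn
  refine ⟨h ^ k, fun he => h1 (hprime.mem_of_pow_mem _ he), ?_⟩
  rw [← mul_pow]
  refine Ideal.pow_le_pow_right hs ?_
  rw [pow_mul]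
  exact Ideal.pow_mem_pow h2 k

lemma isHomogeneous_minor {K : Type*} [Field K] {m n t : ℕ} (r : Fin t → Fin m) (c : Fin t → Fin n) :
    (Matrix.det (Matrix.of fun i j =>
      (MvPolynomial.X (r i, c j) : MvPolynomial (Fin m × Fin n) K))).IsHomogeneous t := by
  rw [Matrix.det_apply]
  apply MvPolynomial.IsHomogeneous.sum
  intro σ _
  rw [Units.smul_def, ← Int.cast_smul_eq_zsmul K, MvPolynomial.smul_eq_C_mul]
  have h := MvPolynomial.IsHomogeneous.prod Finset.univ
    (fun i => (MvPolynomial.X (r (σ i), c i) : MvPolynomial (Fin m × Fin n) K)) (fun _ => 1)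
    (fun i _ => MvPolynomial.isHomogeneous_X _ _)
  have h2 := (MvPolynomial.isHomogeneous_C (Fin m × Fin n) ((Equiv.Perm.sign σ : ℤ) : K)).mul h
  simpa using h2

lemma minor_ne_zero {K : Type*} [Field K] {m n t : ℕ} (r : Fin t → Fin m) (c : Fin t → Fin n)
    (hr : Function.Injective r) (hc : Function.Injective c) :
    (Matrix.det (Matrix.of fun i j =>
      (MvPolynomial.X (r i, c j) : MvPolynomial (Fin m × Fin n) K))) ≠ 0 := by
  classical
  intro h
  let ψ : MvPolynomial (Fin m × Fin n) K →ₐ[K] K :=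
    MvPolynomial.aeval fun z => if ∃ i, z = (r i, c i) then 1 else 0
  have h2 := congrArg ψ h
  rw [map_zero, AlgHom.map_det] at h2
  have h3 : ψ.mapMatrix (Matrix.of fun i j =>
      (MvPolynomial.X (r i, c j) : MvPolynomial (Fin m × Fin n) K)) = 1 := by
    ext i j
    simp only [ψ, AlgHom.mapMatrix_apply, Matrix.map_apply, Matrix.of_apply,
      MvPolynomial.aeval_X, Matrix.one_apply]
    congr 1
    simp only [Prod.mk.injEq, eq_iff_iff]
    constructor
    · rintro ⟨k, h1, h2⟩
      exact (hr h1).trans (hc h2).symm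
    · rintro rfl
      exact ⟨i, rfl, rfl⟩
  rw [h3, Matrix.det_one] at h2
  exact one_ne_zero h2

lemma maxMinor_pow_homog (K : Type*) [Field K] (m n : ℕ) (hmn : m ≤ n) (k : ℕ) :
    (maxMinor K m n hmn ^ k).IsHomogeneous (m * k) ∧ maxMinor K m n hmn ^ k ≠ 0 :=
  ⟨(isHomogeneous_minor _ _).pow k,
    pow_ne_zero _ (minor_ne_zero id (Fin.castLE hmn) Function.injective_id (Fin.castLE_injective hmn))⟩

lemma degree_ge_of_mem_pow {K : Type*} [Field K] {m n t e : ℕ} {f : MvPolynomial (Fin m × Fin n) K}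
    (hf : f ∈ genericMinors K m n t ^ e) {d : ℕ} (hd : f.IsHomogeneous d) (h0 : f ≠ 0) :
    t * e ≤ d := by
  have h1 : genericMinors K m n t ≤ MvPolynomial.idealOfVars (Fin m × Fin n) K ^ t := by
    rw [genericMinors, Ideal.span_le]
    rintro _ ⟨r, c, _, _, rfl⟩
    rw [SetLike.mem_coe, MvPolynomial.mem_pow_idealOfVars_iff]
    intro x hx
    have := isHomogeneous_minor r c (MvPolynomial.mem_support_iff.1 hx)
    rw [Finsupp.degree_eq_weight_one]
    exact this.ge
  have h2 := Ideal.pow_right_mono h1 e hf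
  rw [← pow_mul, MvPolynomial.mem_pow_idealOfVars_iff] at h2
  obtain ⟨x, hx⟩ := MvPolynomial.support_nonempty.2 h0
  have h3 := h2 x hx
  have h4 := hd (MvPolynomial.mem_support_iff.1 hx)
  rw [Finsupp.degree_eq_weight_one] at h3
  exact h3.trans h4.le

abbrev UWRing (K : Type*) [Field K] (m n : ℕ) :=
  MvPolynomial ((Fin m × Fin m) ⊕ (Fin m × Fin n)) K

noncomputable def PsiUW (K : Type*) [Field K] (m n : ℕ) :
    MvPolynomial (Fin m × Fin n) K →ₐ[K] MvPolynomial (Fin m) (UWRing K m n) :=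
  MvPolynomial.aeval fun z => ∑ l : Fin m,
    MvPolynomial.C (MvPolynomial.X (Sum.inl (z.1, l))) * MvPolynomial.X l *
      MvPolynomial.C (MvPolynomial.X (Sum.inr (l, z.2)))

noncomputable def thetaS {m : ℕ} (L : Type*) [CommRing L] (S : Finset (Fin m)) :
    MvPolynomial (Fin m) L →ₐ[L] Polynomial (MvPolynomial (Fin m) L) :=
  MvPolynomial.aeval fun l => Polynomial.C (MvPolynomial.X l) * Polynomial.X ^ (if l ∈ S then 1 else 0)

lemma thetaS_monomial {m : ℕ} {L : Type*} [CommRing L] (S : Finset (Fin m)) (b : Fin m →₀ ℕ)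
    (a : L) : thetaS L S (MvPolynomial.monomial b a) =
      Polynomial.monomial (∑ i ∈ S, b i) (MvPolynomial.monomial b a) := by
  classical
  rw [thetaS, MvPolynomial.aeval_monomial, Finsupp.prod_fintype _ _ (by simp)]
  simp_rw [mul_pow]
  rw [Finset.prod_mul_distrib]
  have h1 : ∏ x, (Polynomial.X ^ (if x ∈ S then 1 else 0) :
      Polynomial (MvPolynomial (Fin m) L)) ^ (b x) = Polynomial.X ^ (∑ i ∈ S, b i) := by
    simp_rw [← pow_mul]
    rw [Finset.prod_pow_eq_pow_sum]
    congr 1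
    simp [ite_mul]
  have h2 : ∏ x, (Polynomial.C (MvPolynomial.X x) : Polynomial (MvPolynomial (Fin m) L)) ^ (b x) =
      Polynomial.C (∏ x, MvPolynomial.X x ^ b x) := by
    simp [map_prod]
  rw [h1, h2, ← Polynomial.C_mul_X_pow_eq_monomial, MvPolynomial.monomial_eq,
    Finsupp.prod_fintype _ _ (by simp), map_mul, mul_assoc]
  rfl

lemma thetaS_coeff {m : ℕ} {L : Type*} [CommRing L] (S : Finset (Fin m)) (b : Fin m →₀ ℕ)
    (g : MvPolynomial (Fin m) L) :
    ((thetaS L S g).coeff (∑ i ∈ S, b i)).coeff b = g.coeff b := by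
  classical
  induction g using MvPolynomial.induction_on' with
  | monomial b' a =>
    rw [thetaS_monomial, Polynomial.coeff_monomial]
    by_cases h : b' = b
    · subst h; simp
    · split_ifs <;> simp [MvPolynomial.coeff_monomial, h]
  | add p p' h1 h2 => rw [map_add, Polynomial.coeff_add, MvPolynomial.coeff_add, h1, h2,
      MvPolynomial.coeff_add]

lemma minorsId_diag_le {m t : ℕ} {O : Type*} [CommRing O] (ε : O) (S : Finset (Fin m))
    (d : Fin m → O) (hd : ∀ l ∈ S, ε ∣ d l) (hS : m < t + S.card) :
    minorsId t (Matrix.diagonal d) ≤ Ideal.span {ε} := by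
  classical
  rw [minorsId, Ideal.span_le]
  rintro _ ⟨r, c, rfl⟩
  rw [SetLike.mem_coe, Ideal.mem_span_singleton]
  by_cases hr : Function.Injective r
  · have : ∃ i, r i ∈ S := by
      by_contra hcon
      push Not at hcon
      have h1 : Finset.univ.image r ⊆ Sᶜ := by
        intro x hx
        obtain ⟨i, _, rfl⟩ := Finset.mem_image.1 hx
        simpa using hcon i
      have h2 := Finset.card_le_card h1
      rw [Finset.card_image_of_injective _ hr, Finset.card_compl, Finset.card_univ,
        Fintype.card_fin, Fintype.card_fin] at h2
      have := Finset.card_le_univ S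
      rw [Fintype.card_fin] at this
      omega
    obtain ⟨i0, hi0⟩ := this
    rw [Matrix.det_apply]
    refine Finset.dvd_sum fun σ _ => ?_
    rw [Units.smul_def]
    apply dvd_zsmul_of_dvd
    refine dvd_trans ?_ (Finset.dvd_prod_of_mem _ (Finset.mem_univ (σ.symm i0)))
    simp only [Matrix.submatrix_apply, Equiv.apply_symm_apply, Matrix.diagonal_apply]
    split_ifs
    · exact hd _ hi0
    · exact dvd_zero _
  · simp only [Function.Injective, not_forall] at hr
    obtain ⟨a, b, hab, hne⟩ := hr
    rw [Matrix.det_zero_of_row_eq hne (by ext j; simp [hab])]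
    exact dvd_zero _

lemma theta_Psi_minors (K : Type*) [Field K] (m n t : ℕ) (S : Finset (Fin m))
    (hS : m < t + S.card) :
    Ideal.map ((thetaS (UWRing K m n) S).toRingHom.comp (PsiUW K m n).toRingHom)
      (genericMinors K m n t) ≤ Ideal.span {Polynomial.X} := by
  classical
  rw [map_genericMinors]
  have : (Matrix.of fun i j => ((thetaS (UWRing K m n) S).toRingHom.comp (PsiUW K m n).toRingHom)
      (MvPolynomial.X (i, j))) =
      (Matrix.of fun i l => Polynomial.C (MvPolynomial.C (MvPolynomial.X (Sum.inl (i, l)))) :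
        Matrix (Fin m) (Fin m) (Polynomial (MvPolynomial (Fin m) (UWRing K m n)))) *
      (Matrix.diagonal fun l => Polynomial.C (MvPolynomial.X l) *
        Polynomial.X ^ (if l ∈ S then 1 else 0)) *
      (Matrix.of fun l j => Polynomial.C (MvPolynomial.C (MvPolynomial.X (Sum.inr (l, j)))) :
        Matrix (Fin m) (Fin n) (Polynomial (MvPolynomial (Fin m) (UWRing K m n)))) := by
    ext1 i j
    rw [Matrix.mul_apply]
    simp only [Matrix.mul_diagonal, Matrix.of_apply]
    simp only [PsiUW, thetaS, AlgHom.toRingHom_eq_coe, RingHom.coe_comp, RingHom.coe_coe,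
      Function.comp_apply, MvPolynomial.aeval_X, map_sum, map_mul, MvPolynomial.aeval_C]
    rfl
  rw [this]
  refine (minorsId_mul_right _ _ _).trans ((minorsId_mul_left _ _ _).trans ?_)
  refine minorsId_diag_le _ S _ ?_ hS
  intro l hl
  simp [hl]

lemma theta_Psi_not_dvd (K : Type*) [Field K] (m n q : ℕ) (S : Finset (Fin m))
    (hS : S.card + q = m) (h : MvPolynomial (Fin m × Fin n) K)
    (hh : h ∉ genericMinors K m n (q + 1)) :
    ¬ Polynomial.X ∣ thetaS (UWRing K m n) S (PsiUW K m n h) := by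
  classical
  intro hdvd
  apply hh
  rw [genericMinors_eq_ker, RingHom.mem_ker]
  have hcard : Fintype.card {l // l ∉ S} = Fintype.card (Fin q) := by
    rw [Fintype.card_subtype_compl, Fintype.card_fin, Fintype.card_fin, Fintype.card_coe]
    omega
  let e : {l // l ∉ S} ≃ Fin q := Fintype.equivOfCardEq hcard
  let Tgt := MvPolynomial ((Fin m × Fin q) ⊕ (Fin q × Fin n)) K
  let eL : UWRing K m n →ₐ[K] Tgt := MvPolynomial.aeval (Sum.elim
    (fun x => if hx : x.2 ∉ S then MvPolynomial.X (Sum.inl (x.1, e ⟨x.2, hx⟩)) else 0)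
    (fun x => if hx : x.1 ∉ S then MvPolynomial.X (Sum.inr (e ⟨x.1, hx⟩, x.2)) else 0))
  let ey : MvPolynomial (Fin m) (UWRing K m n) →+* Tgt :=
    MvPolynomial.eval₂Hom (eL : UWRing K m n →+* Tgt) (fun _ => 1)
  let ze : Polynomial (MvPolynomial (Fin m) (UWRing K m n)) →+* Tgt :=
    Polynomial.eval₂RingHom ey 0
  have hcomp : (ze.comp ((thetaS (UWRing K m n) S).toRingHom.comp (PsiUW K m n).toRingHom)) =
      (phiAB K m n q).toRingHom := by
    apply MvPolynomial.ringHom_ext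
    · intro a
      have h1 : (PsiUW K m n) (MvPolynomial.C a) = MvPolynomial.C (MvPolynomial.C a) :=
        (PsiUW K m n).commutes a
      have h2 : (phiAB K m n q) (MvPolynomial.C a) = MvPolynomial.C a :=
        (phiAB K m n q).commutes a
      have h3 : (thetaS (UWRing K m n) S) (MvPolynomial.C (MvPolynomial.C a)) =
        Polynomial.C (MvPolynomial.C (MvPolynomial.C a)) :=
        (thetaS (UWRing K m n) S).commutes _
      have h4 : eL (MvPolynomial.C a) = MvPolynomial.C a := eL.commutes a
      simp only [AlgHom.toRingHom_eq_coe, RingHom.coe_comp, RingHom.coe_coe,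
        Function.comp_apply, h1, h2, h3]
      simp [ze, ey, h4]
    · rintro ⟨i, j⟩
      have h3 : ∀ a, (thetaS (UWRing K m n) S) (MvPolynomial.C a) =
        Polynomial.C (MvPolynomial.C a) := fun a => (thetaS (UWRing K m n) S).commutes _
      have h5 : ∀ l, (thetaS (UWRing K m n) S) (MvPolynomial.X l) =
        Polynomial.C (MvPolynomial.X l) * Polynomial.X ^ (if l ∈ S then 1 else 0) := by
        intro l; simp [thetaS]
      simp only [AlgHom.toRingHom_eq_coe, RingHom.coe_comp, RingHom.coe_coe,
        Function.comp_apply, PsiUW, phiAB, MvPolynomial.aeval_X, map_sum, map_mul, h3, h5]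
      rw [← Fintype.sum_subtype_add_sum_subtype (fun l => l ∈ S)]
      rw [Finset.sum_eq_zero, zero_add]
      · refine Fintype.sum_equiv e _ _ ?_
        intro l
        simp [ze, ey, eL, l.2]
      · intro l _
        simp [ze, ey, eL, l.2]
  have h1 : ze (thetaS (UWRing K m n) S (PsiUW K m n h)) = phiAB K m n q h :=
    congrArg (fun F => F h) hcomp
  obtain ⟨c, hc⟩ := hdvd
  rw [← h1, hc, map_mul]
  simp [ze]

lemma Psi_support_ge (K : Type*) [Field K] (m n q s : ℕ) (S : Finset (Fin m))
    (hS : S.card + q = m) (f : MvPolynomial (Fin m × Fin n) K)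
    (hf : f ∈ symbolicPower (genericMinors K m n (q + 1)) s) (b : Fin m →₀ ℕ)
    (hb : b ∈ (PsiUW K m n f).support) : s ≤ ∑ i ∈ S, b i := by
  rw [mem_symbolicPower_iff _ (genericMinors_isPrime K m n q)] at hf
  obtain ⟨h, hh, hhf⟩ := hf
  have h1 := Ideal.mem_map_of_mem
    ((thetaS (UWRing K m n) S).toRingHom.comp (PsiUW K m n).toRingHom) hhf
  rw [Ideal.map_pow] at h1
  have h2 := Ideal.pow_right_mono (theta_Psi_minors K m n (q + 1) S (by omega)) s h1
  rw [Ideal.span_singleton_pow, Ideal.mem_span_singleton, map_mul] at h2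
  have h3 := Polynomial.prime_X.pow_dvd_of_dvd_mul_left s (theta_Psi_not_dvd K m n q S hS h hh) h2
  by_contra hlt
  rw [not_le] at hlt
  rw [MvPolynomial.mem_support_iff, ← thetaS_coeff S] at hb
  apply hb
  have h4 := Polynomial.X_pow_dvd_iff.1 h3 _ hlt
  have h5 : ((thetaS (UWRing K m n) S) ((PsiUW K m n) f)).coeff (∑ i ∈ S, b i) = 0 := h4
  rw [h5, MvPolynomial.coeff_zero]

lemma avg_bound {ι : Type*} [DecidableEq ι] (b : ι → ℕ) (p s : ℕ) (hp : 1 ≤ p) (A : Finset ι)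
    (hA : p ≤ A.card) (h : ∀ S ⊆ A, S.card = p → s ≤ ∑ i ∈ S, b i) :
    A.card * s ≤ p * ∑ i ∈ A, b i := by
  obtain ⟨k, hk⟩ := Nat.exists_eq_add_of_le hA
  induction k generalizing A with
  | zero =>
    have := h A subset_rfl (by omega)
    rw [show A.card = p by omega]
    exact Nat.mul_le_mul_left _ this
  | succ k ih =>
    have h1 : ∀ a ∈ A, (p + k) * s + p * b a ≤ p * ∑ i ∈ A, b i := by
      intro a ha
      have hc : (A.erase a).card = p + k := by rw [Finset.card_erase_of_mem ha]; omega
      have := ih (A.erase a) (by omega) (fun S hS => h S (hS.trans (Finset.erase_subset _ _))) hc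
      rw [hc] at this
      rw [← Finset.add_sum_erase A b ha, mul_add]
      omega
    have h2 := Finset.sum_le_sum h1
    rw [Finset.sum_add_distrib, Finset.sum_const, Finset.sum_const, ← Finset.mul_sum, hk,
      smul_eq_mul, smul_eq_mul] at h2
    rw [hk]
    have h3 : (p + k) * ((p + (k + 1)) * s) ≤ (p + k) * (p * ∑ i ∈ A, b i) := by nlinarith
    exact Nat.le_of_mul_le_mul_left h3 (by omega)

lemma Psi_ne_zero (K : Type*) [Field K] (m n : ℕ) (f : MvPolynomial (Fin m × Fin n) K)
    (hf : f ≠ 0) : PsiUW K m n f ≠ 0 := by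
  classical
  intro h
  let eL : UWRing K m n →ₐ[K] MvPolynomial (Fin m × Fin n) K := MvPolynomial.aeval (Sum.elim
    (fun x => if x.1 = x.2 then 1 else 0) (fun x => MvPolynomial.X x))
  let ey : MvPolynomial (Fin m) (UWRing K m n) →+* MvPolynomial (Fin m × Fin n) K :=
    MvPolynomial.eval₂Hom (eL : UWRing K m n →+* _) (fun _ => 1)
  have hcomp : ey.comp (PsiUW K m n).toRingHom = RingHom.id _ := by
    apply MvPolynomial.ringHom_ext
    · intro a
      have h1 : (PsiUW K m n) (MvPolynomial.C a) = MvPolynomial.C (MvPolynomial.C a) :=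
        (PsiUW K m n).commutes a
      have h4 : eL (MvPolynomial.C a) = MvPolynomial.C a := eL.commutes a
      simp only [AlgHom.toRingHom_eq_coe, RingHom.coe_comp, RingHom.coe_coe,
        Function.comp_apply, h1]
      simp [ey, h4]
    · rintro ⟨i, j⟩
      simp [PsiUW, ey, eL]
  have := congrArg (fun F => F f) hcomp
  simp only [AlgHom.toRingHom_eq_coe, RingHom.coe_comp, RingHom.coe_coe,
        Function.comp_apply, h, map_zero, RingHom.id_apply] at this
  exact hf this.symm

lemma Psi_homog (K : Type*) [Field K] (m n d : ℕ) (f : MvPolynomial (Fin m × Fin n) K)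
    (hf : f.IsHomogeneous d) : (PsiUW K m n f).IsHomogeneous d := by
  rw [f.as_sum, map_sum]
  apply MvPolynomial.IsHomogeneous.sum
  intro M hM
  have hd := hf (MvPolynomial.mem_support_iff.1 hM)
  rw [PsiUW, MvPolynomial.aeval_monomial]
  have h1 : (algebraMap K (MvPolynomial (Fin m) (UWRing K m n)) (f.coeff M)).IsHomogeneous 0 :=
    MvPolynomial.isHomogeneous_C _ _
  have h2 := MvPolynomial.IsHomogeneous.prod M.support
    (fun z => (∑ l : Fin m,
    MvPolynomial.C (MvPolynomial.X (Sum.inl (z.1, l))) * MvPolynomial.X l *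
      MvPolynomial.C (MvPolynomial.X (Sum.inr (l, z.2))) :
      MvPolynomial (Fin m) (UWRing K m n)) ^ M z) (fun z => 1 * M z) (by
    intro z _
    apply MvPolynomial.IsHomogeneous.pow
    apply MvPolynomial.IsHomogeneous.sum
    intro l _
    have := ((MvPolynomial.isHomogeneous_C (Fin m)
      (MvPolynomial.X (Sum.inl (z.1, l)) : UWRing K m n)).mul
      (MvPolynomial.isHomogeneous_X (UWRing K m n) l)).mul
      (MvPolynomial.isHomogeneous_C (Fin m)
      (MvPolynomial.X (Sum.inr (l, z.2)) : UWRing K m n))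
    simpa using this)
  have h3 := h1.mul h2
  have h4 : 0 + ∑ z ∈ M.support, 1 * M z = d := by
    rw [← hd, Finsupp.weight_apply]
    simp [Finsupp.sum]
  rw [h4] at h3
  exact h3

lemma alpha_lower (K : Type*) [Field K] (p n q s d : ℕ) (hp : 1 ≤ p)
    (f : MvPolynomial (Fin (q + p) × Fin n) K)
    (hf : f ∈ symbolicPower (genericMinors K (q + p) n (q + 1)) s) (hd : f.IsHomogeneous d)
    (h0 : f ≠ 0) : (q + p) * s ≤ p * d := by
  classical
  obtain ⟨b, hb⟩ := MvPolynomial.support_nonempty.2 (Psi_ne_zero K (q + p) n f h0)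
  have hdeg := Psi_homog K (q + p) n d f hd (MvPolynomial.mem_support_iff.1 hb)
  have := avg_bound b p s hp Finset.univ (by simp) (fun S _ hS =>
    Psi_support_ge K (q + p) n q s S (by omega) f hf b hb)
  rw [Finset.card_univ, Fintype.card_fin] at this
  rw [Finsupp.weight_apply, Finsupp.sum_fintype _ _ (by simp)] at hdeg
  simp at hdeg
  rwa [hdeg] at this


/-! ### Smith-type peeling over valuation rings -/

lemma exists_dvd_all {O α : Type*} [CommRing O] [IsDomain O] [ValuationRing O] [Finite α]
    [Nonempty α] (f : α → O) : ∃ a, ∀ b, f a ∣ f b := by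
  classical
  have := Fintype.ofFinite α
  have : ∀ S : Finset α, S.Nonempty → ∃ a, ∀ b ∈ S, f a ∣ f b := by
    intro S hS
    induction hS using Finset.Nonempty.cons_induction with
    | singleton a => exact ⟨a, by simp⟩
    | cons a S ha hS ih =>
      obtain ⟨c, hc⟩ := ih
      rcases ValuationRing.dvd_total (f a) (f c) with h | h
      · refine ⟨a, fun b hb => ?_⟩
        rcases Finset.mem_cons.1 hb with rfl | hb
        · exact dvd_rfl
        · exact h.trans (hc b hb)
      · refine ⟨c, fun b hb => ?_⟩
        rcases Finset.mem_cons.1 hb with rfl | hb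
        · exact h
        · exact hc b hb
  obtain ⟨a, ha⟩ := this Finset.univ Finset.univ_nonempty
  exact ⟨a, fun b => ha b (Finset.mem_univ b)⟩

lemma minor_peel {O : Type*} [CommRing O] {ι κ : Type*} (Y : Matrix ι κ O) (p0 : ι) (q0 : κ)
    (y : ι → O) (hy : ∀ i, Y i q0 = y i * Y p0 q0) (t : ℕ) (r : Fin t → ι) (c : Fin t → κ) :
    Y p0 q0 * ((Matrix.of fun i j => Y i j - y i * Y p0 j).submatrix r c).det
      = (Y.submatrix (Fin.cons p0 r : Fin (t+1) → ι) (Fin.cons q0 c : Fin (t+1) → κ)).det := by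
  have h := Matrix.det_eq_of_forall_row_eq_smul_add_const
    (A := Y.submatrix (Fin.cons p0 r : Fin (t+1) → ι) (Fin.cons q0 c : Fin (t+1) → κ))
    (B := Matrix.of fun (i j : Fin (t+1)) => (Fin.cons (Y p0 ((Fin.cons q0 c : Fin (t+1) → κ) j))
      (fun i' => Y (r i') ((Fin.cons q0 c : Fin (t+1) → κ) j) - y (r i') * Y p0
      ((Fin.cons q0 c : Fin (t+1) → κ) j)) : Fin (t+1) → O) i)
    (Fin.cons 0 (fun i' => y (r i'))) 0 (by simp) (by
      intro i j
      refine Fin.cases ?_ (fun i => ?_) i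
      · simp
      · simp)
  rw [h, Matrix.det_succ_column_zero, Fin.sum_univ_succ]
  rw [Finset.sum_eq_zero]
  · simp only [Matrix.of_apply, Fin.cons_zero, Fin.val_zero, pow_zero, one_mul, add_zero]
    congr 2
  · intro i _
    have : Y (r i) q0 - y (r i) * Y p0 q0 = 0 := by rw [← hy, sub_self]
    simp [this]

lemma smith_peel {O : Type*} [CommRing O] [IsDomain O] [ValuationRing O] (m n : ℕ) (μ : ℕ) :
    ∀ (Y : Matrix (Fin m) (Fin n) O) (Z : Finset (Fin m)), Z.card ≤ μ →
      (∀ i, i ∉ Z → ∀ j, Y i j = 0) →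
    ∃ (a : ℕ → O) (U : Fin m → ℕ → O) (W : ℕ → Fin n → O),
      (∀ i j, Y i j = ∑ l ∈ Finset.range μ, U i l * a l * W l j) ∧
      (∀ l, a l ∣ a (l + 1)) ∧
      (∀ t, ∏ l ∈ Finset.range t, a l ∈ minorsId t Y) ∧
      (∀ d, (∀ i j, d ∣ Y i j) → d ∣ a 0) := by
  classical
  have zero_case : ∀ (ν : ℕ) (Y : Matrix (Fin m) (Fin n) O), Y = 0 →
    ∃ (a : ℕ → O) (U : Fin m → ℕ → O) (W : ℕ → Fin n → O),
      (∀ i j, Y i j = ∑ l ∈ Finset.range ν, U i l * a l * W l j) ∧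
      (∀ l, a l ∣ a (l + 1)) ∧
      (∀ t, ∏ l ∈ Finset.range t, a l ∈ minorsId t Y) ∧
      (∀ d, (∀ i j, d ∣ Y i j) → d ∣ a 0) := by
    rintro ν Y rfl
    refine ⟨0, 0, 0, by simp, by simp, ?_, by simp⟩
    intro t
    cases t with
    | zero =>
      refine Ideal.subset_span ⟨Fin.elim0, Fin.elim0, ?_⟩
      simp
    | succ t => simp
  induction μ with
  | zero =>
    intro Y Z hZ hY
    refine zero_case 0 Y ?_
    have : Z = ∅ := by simpa using hZ
    ext i j
    exact hY i (by simp [this]) j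
  | succ μ ih =>
    intro Y Z hZ hY
    by_cases h0 : Y = 0
    · exact zero_case _ Y h0
    have hne : ∃ i j, Y i j ≠ 0 := by
      by_contra hcon
      push Not at hcon
      exact h0 (by ext i j; exact hcon i j)
    obtain ⟨i1, j1, hij⟩ := hne
    have : Nonempty (Fin m × Fin n) := ⟨(i1, j1)⟩
    obtain ⟨⟨p0, q0⟩, hdiv⟩ := exists_dvd_all (fun z : Fin m × Fin n => Y z.1 z.2)
    have hx0 : Y p0 q0 ≠ 0 := fun h => hij (by simpa [h] using hdiv (i1, j1))
    have hp0 : p0 ∈ Z := by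
      by_contra h; exact hx0 (hY _ h _)
    choose y hy using fun i : Fin m => hdiv (i, q0)
    simp only at hy
    have hy' : ∀ i, Y i q0 = y i * Y p0 q0 := fun i => by rw [mul_comm]; exact hy i
    set Y' : Matrix (Fin m) (Fin n) O := Matrix.of fun i j => Y i j - y i * Y p0 j with hY'
    have hyp : y p0 = 1 := by
      have := hy' p0
      exact (mul_right_cancel₀ hx0 (by rw [one_mul]; exact this)).symm
    choose w hw using fun j : Fin n => hdiv (p0, j)
    simp only at hw
    obtain ⟨a, U, W, h1, h2, h3, h4⟩ := ih Y' (Z.erase p0) (by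
        rw [Finset.card_erase_of_mem hp0]; omega) (by
      intro i hi j
      by_cases hip : i = p0
      · subst hip; simp [hY', hyp]
      · have hiZ : i ∉ Z := fun h => hi (Finset.mem_erase.2 ⟨hip, h⟩)
        have hyi : y i = 0 := by
          have := hy' i
          rw [hY i hiZ] at this
          exact (mul_eq_zero.1 this.symm).resolve_right hx0
        simp [hY', hyi, hY i hiZ])
    refine ⟨fun l => Nat.casesOn l (Y p0 q0) a, fun i l => Nat.casesOn l (y i) (U i),
      fun l j => Nat.casesOn l (w j) (fun l => W l j), ?_, ?_, ?_, ?_⟩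
    · intro i j
      rw [Finset.sum_range_succ']
      simp only
      rw [← h1 i j]
      simp only [hY', Matrix.of_apply]
      rw [hw j]
      change Y i j = Y i j - y i * (Y p0 q0 * w j) + y i * Y p0 q0 * w j
      ring
    · intro l
      cases l with
      | zero =>
        simp only
        apply h4
        intro i j
        simp only [hY', Matrix.of_apply]
        exact dvd_sub (hdiv (i, j)) ((hdiv (p0, j)).mul_left _)
      | succ l => exact h2 l
    · intro t
      cases t with
      | zero => exact Ideal.subset_span ⟨Fin.elim0, Fin.elim0, by simp⟩
      | succ t =>
        rw [Finset.prod_range_succ', mul_comm]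
        simp only
        have key : minorsId t Y' ≤ Submodule.comap
            (LinearMap.mulLeft O (Y p0 q0)) (minorsId (t+1) Y) := by
          refine Ideal.span_le.2 ?_
          rintro _ ⟨r, c, rfl⟩
          simp only [SetLike.mem_coe, Submodule.mem_comap, LinearMap.mulLeft_apply]
          rw [hY', minor_peel Y p0 q0 y hy' t r c]
          exact Ideal.subset_span ⟨_, _, rfl⟩
        exact key (h3 t)
    · intro d hd
      exact hd p0 q0

lemma chain_prod {O : Type*} [CommRing O] (m : ℕ) (e : ℕ → O) (b : ℕ → ℕ) :
    ∏ i ∈ Finset.range m, (∏ j ∈ Finset.range (i + 1), e j) ^ b i =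
      ∏ j ∈ Finset.range m, e j ^ (∑ i ∈ Finset.range m, if j ≤ i then b i else 0) := by
  have h1 : ∀ i ∈ Finset.range m, (∏ j ∈ Finset.range (i + 1), e j) ^ b i =
      ∏ j ∈ Finset.range m, e j ^ (if j ≤ i then b i else 0) := by
    intro i hi
    rw [← Finset.prod_pow]
    have hsub : Finset.range (i + 1) ⊆ Finset.range m := by
      intro x hx; simp at hx hi ⊢; omega
    rw [← Finset.prod_subset hsub]
    · refine Finset.prod_congr rfl fun j hj => ?_
      rw [if_pos (by simp at hj; omega)]
    · intro j _ hj
      rw [if_neg (by simp at hj; omega), pow_zero]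
  rw [Finset.prod_congr rfl h1, Finset.prod_comm]
  exact Finset.prod_congr rfl fun j _ => Finset.prod_pow_eq_pow_sum _ _ _

lemma chain_dvd {O : Type*} [CommRing O] (m : ℕ) (a : ℕ → O) (ha : ∀ l, a l ∣ a (l + 1))
    (b b' : ℕ → ℕ) (h : ∀ j < m, (∑ i ∈ Finset.range m, if j ≤ i then b' i else 0) ≤
      ∑ i ∈ Finset.range m, if j ≤ i then b i else 0) :
    ∏ i ∈ Finset.range m, a i ^ b' i ∣ ∏ i ∈ Finset.range m, a i ^ b i := by
  choose e he using ha
  have hae : ∀ l, a l = ∏ j ∈ Finset.range (l + 1), (fun l => Nat.casesOn l (a 0) e : ℕ → O) j := by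
    intro l
    induction l with
    | zero => simp
    | succ l ih => rw [Finset.prod_range_succ, ← ih, he l]
  have hE : ∀ c : ℕ → ℕ, ∏ i ∈ Finset.range m, a i ^ c i = _ := fun c =>
    (Finset.prod_congr rfl fun i _ => congrArg (fun x => x ^ c i) (hae i)).trans
      (chain_prod m (fun l => Nat.casesOn l (a 0) e : ℕ → O) c)
  rw [hE, hE]
  exact Finset.prod_dvd_prod_of_dvd _ _ fun j hj => pow_dvd_pow _ (h j (by simpa using hj))

lemma val_dvd {O : Type*} [CommRing O] (p q s r : ℕ) (hp : 1 ≤ p)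
    (hsr : r * ((q + 1) * p) ≤ s * (q + p)) (a : ℕ → O) (ha : ∀ l, a l ∣ a (l + 1))
    (b : Fin (q + p) → ℕ)
    (hb : ∀ S : Finset (Fin (q + p)), S.card = p → s ≤ ∑ i ∈ S, b i) :
    (∏ l ∈ Finset.range (q + 1), a l) ^ r ∣ ∏ i : Fin (q + p), a i ^ b i := by
  classical
  let B : ℕ → ℕ := fun i => if h : i < q + p then b ⟨i, h⟩ else 0
  have hB : ∏ i : Fin (q + p), a i ^ b i = ∏ i ∈ Finset.range (q + p), a i ^ B i := by
    rw [Finset.prod_range]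
    exact Finset.prod_congr rfl fun i _ => by simp [B]
  have hL : (∏ l ∈ Finset.range (q + 1), a l) ^ r =
      ∏ i ∈ Finset.range (q + p), a i ^ (if i < q + 1 then r else 0) := by
    rw [← Finset.prod_pow]
    have hsub : Finset.range (q + 1) ⊆ Finset.range (q + p) := by
      intro x hx; simp at hx ⊢; omega
    rw [← Finset.prod_subset hsub]
    · refine Finset.prod_congr rfl fun j hj => ?_
      rw [if_pos (by simpa using hj)]
    · intro j _ hj
      rw [if_neg (by simpa using hj), pow_zero]
  rw [hB, hL]
  apply chain_dvd _ a ha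
  intro j hj
  have hR : (∑ i ∈ Finset.range (q + p), if j ≤ i then B i else 0) =
      ∑ i ∈ (Finset.univ.filter fun i : Fin (q + p) => j ≤ i), b i := by
    rw [Finset.sum_range, Finset.sum_filter]
    exact Finset.sum_congr rfl fun i _ => by simp [B]
  have hLs : (∑ i ∈ Finset.range (q + p), if j ≤ i then (if i < q + 1 then r else 0) else 0) =
      (q + 1 - j) * r := by
    have : ∀ i ∈ Finset.range (q + p), (if j ≤ i then (if i < q + 1 then r else 0) else 0) =
        if i ∈ Finset.Ico j (q + 1) then r else 0 := by
      intro i _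
      simp only [Finset.mem_Ico]
      split_ifs <;> first | rfl | omega
    rw [Finset.sum_congr rfl this, ← Finset.sum_filter, Finset.filter_mem_eq_inter,
      Finset.inter_eq_right.2, Finset.sum_const, Nat.card_Ico, smul_eq_mul]
    intro x hx; simp at hx ⊢; omega
  rw [hR, hLs]
  by_cases hjq : j ≤ q
  swap
  · have : q + 1 - j = 0 := by omega
    simp [this]
  have hcard : (Finset.univ.filter fun i : Fin (q + p) => j ≤ i).card = q + p - j := by
    have := Fin.card_filter_val_lt (n := q + p) (m := j)
    have h2 := Finset.card_filter_add_card_filter_not (s := Finset.univ)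
      (fun i : Fin (q + p) => (i : ℕ) < j)
    simp only [not_lt, Finset.card_univ, Fintype.card_fin] at h2
    rw [this] at h2
    omega
  have hav := avg_bound b p s hp (Finset.univ.filter fun i : Fin (q + p) => j ≤ i)
    (by omega) (fun S _ hS => hb S hS)
  rw [hcard] at hav
  set N := ∑ i ∈ (Finset.univ.filter fun i : Fin (q + p) => j ≤ i), b i
  obtain ⟨d, rfl⟩ : ∃ d, q = j + d := ⟨q - j, by omega⟩
  have e1 : j + d + p - j = d + p := by omega
  have e2 : j + d + 1 - j = d + 1 := by omega
  rw [e1] at hav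
  rw [e2]
  have hm : 0 < j + d + p := by omega
  refine Nat.le_of_mul_le_mul_left ?_ (Nat.mul_pos hm (show 0 < p by omega))
  obtain ⟨p', rfl⟩ : ∃ p', p = p' + 1 := ⟨p - 1, by omega⟩
  calc (j + d + (p' + 1)) * (p' + 1) * ((d + 1) * r)
      ≤ (d + (p' + 1)) * (r * ((j + d + 1) * (p' + 1))) := by
        have : (j + d + (p' + 1)) * (d + 1) ≤ (d + (p' + 1)) * (j + d + 1) := by
          nlinarith [Nat.zero_le (j * p')]
        calc _ = ((j + d + (p' + 1)) * (d + 1)) * ((p' + 1) * r) := by ring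
          _ ≤ ((d + (p' + 1)) * (j + d + 1)) * ((p' + 1) * r) := Nat.mul_le_mul_right _ this
          _ = _ := by ring
    _ ≤ (d + (p' + 1)) * (s * (j + d + (p' + 1))) := Nat.mul_le_mul_left _ hsr
    _ = (j + d + (p' + 1)) * ((d + (p' + 1)) * s) := by ring
    _ ≤ (j + d + (p' + 1)) * ((p' + 1) * N) := Nat.mul_le_mul_left _ hav
    _ = _ := by ring

lemma val_main {K : Type*} [Field K] {O : Type*} [CommRing O] [IsDomain O] [ValuationRing O]
    (p n q s r : ℕ) (hp : 1 ≤ p)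
    (hsr : r * ((q + 1) * p) ≤ s * (q + p))
    (F : MvPolynomial (Fin (q + p) × Fin n) K →+* O) :
    ∃ π ∈ Ideal.map F (genericMinors K (q + p) n (q + 1)), ∀ k,
      ∀ f ∈ symbolicPower (genericMinors K (q + p) n (q + 1)) (s * k), π ^ (r * k) ∣ F f := by
  classical
  obtain ⟨a, U, W, h1, h2, h3, -⟩ := smith_peel (q + p) n (q + p)
    (Matrix.of fun i j => F (X (i, j))) Finset.univ (by simp) (by simp)
  refine ⟨_, by rw [map_genericMinors]; exact h3 (q + 1), ?_⟩
  intro k f hf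
  let g : UWRing K (q + p) n →+* O := MvPolynomial.eval₂Hom (F.comp MvPolynomial.C)
    (Sum.elim (fun z => U z.1 z.2) (fun z => W z.1 z.2))
  let G : MvPolynomial (Fin (q + p)) (UWRing K (q + p) n) →+* O :=
    MvPolynomial.eval₂Hom g (fun i => a i)
  have hG : G.comp (PsiUW K (q + p) n).toRingHom = F := by
    apply MvPolynomial.ringHom_ext
    · intro x
      have h1 : (PsiUW K (q + p) n) (MvPolynomial.C x) = MvPolynomial.C (MvPolynomial.C x) :=
        (PsiUW K (q + p) n).commutes x
      simp only [AlgHom.toRingHom_eq_coe, RingHom.coe_comp, RingHom.coe_coe,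
        Function.comp_apply, h1]
      simp [G, g]
    · rintro ⟨i, j⟩
      have := h1 i j
      rw [Matrix.of_apply, Finset.sum_range] at this
      rw [this]
      simp [PsiUW, G, g]
  have hff : F f = G (PsiUW K (q + p) n f) := by
    conv_lhs => rw [← hG]
    rfl
  rw [hff]
  change _ ∣ MvPolynomial.eval₂ g (fun i : Fin (q + p) => a i) _
  rw [MvPolynomial.eval₂_eq']
  refine Finset.dvd_sum fun b hb => Dvd.dvd.mul_left ?_ _
  refine val_dvd p q (s * k) (r * k) hp ?_ a h2 b ?_
  · calc r * k * ((q + 1) * p) = (r * ((q + 1) * p)) * k := by ring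
      _ ≤ s * (q + p) * k := Nat.mul_le_mul_right _ hsr
      _ = _ := by ring
  · intro S hS
    exact Psi_support_ge K (q + p) n q (s * k) S (by omega) f hf b hb

lemma rees_val_integral {R : Type*} [CommRing R] (J : Ideal R) {E : Type*} [Field E]
    (φ : Polynomial R →+* E) (k : ℕ) (f : R)
    (h : ∀ (V : ValuationSubring E) (F : R →+* V), ∃ π ∈ Ideal.map F J, π ^ k ∣ F f) :
    φ (Polynomial.monomial k f) ∈ integralClosure (Subring.closure
      (φ '' (reesAlgebra J : Set (Polynomial R)))) E := by
  classical
  rw [← Subalgebra.mem_toSubring, ← iInf_valuationSubring_superset, Subring.mem_iInf]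
  rintro ⟨V, hV⟩
  change φ (Polynomial.monomial k f) ∈ V
  have hC : ∀ x, φ (Polynomial.C x) ∈ V := fun x =>
    hV ⟨_, (reesAlgebra J).algebraMap_mem x, rfl⟩
  let F : R →+* V := (φ.comp Polynomial.C).codRestrict V hC
  obtain ⟨π, hπ, c, hc⟩ := h V F
  let τ : E := φ Polynomial.X
  let N : Submodule V V :=
    { carrier := {x | (x : E) * τ ∈ V}
      add_mem' := by
        intro x y hx hy
        have : ((x + y : V) : E) * τ = x * τ + y * τ := by push_cast; ring
        change ((x + y : V) : E) * τ ∈ V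
        rw [this]
        exact add_mem hx hy
      zero_mem' := by
        change ((0 : V) : E) * τ ∈ V
        simp
      smul_mem' := by
        intro x y hy
        change ((x * y : V) : E) * τ ∈ V
        have : ((x * y : V) : E) * τ = x * (y * τ) := by push_cast; ring
        rw [this]
        exact mul_mem x.2 hy }
  have hN : Ideal.map F J ≤ N := by
    refine Ideal.span_le.2 ?_
    rintro _ ⟨y, hy, rfl⟩
    change φ (Polynomial.C y) * φ Polynomial.X ∈ V
    rw [← map_mul]
    refine hV ⟨_, ?_, rfl⟩
    rw [Polynomial.C_mul_X_eq_monomial]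
    exact reesAlgebra.monomial_mem.2 (by simpa using hy)
  have hτ : (π : E) * τ ∈ V := hN hπ
  have : φ (Polynomial.monomial k f) = c * ((π : E) * τ) ^ k := by
    rw [← Polynomial.C_mul_X_pow_eq_monomial, map_mul, map_pow]
    have h2 : φ (Polynomial.C f) = ((F f : V) : E) := rfl
    rw [h2, hc]
    push_cast
    rw [mul_pow]
    change _ * τ ^ k = _
    ring
  rw [this]
  exact mul_mem c.2 (pow_mem hτ k)

lemma integral_main {K : Type*} [Field K]
    (p n q s r : ℕ) (hp : 1 ≤ p)
    (hsr : r * ((q + 1) * p) ≤ s * (q + p))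
    {E : Type*} [Field E] (φ : Polynomial (MvPolynomial (Fin (q + p) × Fin n) K) →+* E) (k : ℕ)
    (f : MvPolynomial (Fin (q + p) × Fin n) K)
    (hf : f ∈ symbolicPower (genericMinors K (q + p) n (q + 1)) (s * k)) :
    φ (Polynomial.monomial k f) ∈ integralClosure (Subring.closure
      (φ '' (reesAlgebra (genericMinors K (q + p) n (q + 1) ^ r) :
        Set (Polynomial (MvPolynomial (Fin (q + p) × Fin n) K))))) E := by
  apply rees_val_integral
  intro V F
  obtain ⟨π, hπ, hdiv⟩ := val_main p n q s r hp hsr F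
  refine ⟨π ^ r, ?_, ?_⟩
  · rw [Ideal.map_pow]; exact Ideal.pow_mem_pow hπ r
  · rw [← pow_mul]; exact hdiv k f hf

/-! ### Finiteness of the integral closure -/

lemma finite_integralClosure (K B E : Type*) [Field K] [CharZero K] [CommRing B] [IsDomain B]
    [Algebra K B] [Algebra.FiniteType K B] [Field E] [Algebra B E] [IsFractionRing B E] :
    Module.Finite B (integralClosure B E) := by
  obtain ⟨s, g, ginj, gfin⟩ := exists_finite_inj_algHom_of_fg K B
  let A := MvPolynomial (Fin s) K
  let : Algebra A B := g.toRingHom.toAlgebra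
  let : Algebra A E := ((algebraMap B E).comp g.toRingHom).toAlgebra
  have : IsScalarTower A B E := IsScalarTower.of_algebraMap_eq fun x => rfl
  have : Module.Finite A B := gfin
  have hAB : Function.Injective (algebraMap A B) := ginj
  have hAE : Function.Injective (algebraMap A E) :=
    (IsFractionRing.injective B E).comp hAB
  have : FaithfulSMul A B := (faithfulSMul_iff_algebraMap_injective A B).2 hAB
  have : FaithfulSMul A E := (faithfulSMul_iff_algebraMap_injective A E).2 hAE
  let : Algebra (FractionRing A) E := FractionRing.liftAlgebra A E
  have : IsScalarTower A (FractionRing A) E := FractionRing.isScalarTower_liftAlgebra A E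
  have : Algebra.IsIntegral A B := inferInstance
  have : FiniteDimensional (FractionRing A) E := .of_isLocalization A B (nonZeroDivisors A)
  have : CharZero (FractionRing A) := charZero_of_injective_algebraMap
    (R := K) (A := FractionRing A) (FaithfulSMul.algebraMap_injective _ _)
  have : IsIntegralClosure (integralClosure B E) A E :=
    { algebraMap_injective := Subtype.val_injective
      isIntegral_iff := by
        intro x
        constructor
        · intro h
          exact ⟨⟨x, h.tower_top⟩, rfl⟩
        · rintro ⟨y, rfl⟩
          exact isIntegral_trans (R := A) (A := B) _ y.2 }
  have : Module.Finite A (integralClosure B E) :=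
    IsIntegralClosure.finite A (FractionRing A) E (integralClosure B E)
  exact Module.Finite.of_restrictScalars_finite A B _

lemma rees_isFractionRing {R : Type*} [CommRing R] [IsDomain R] (J : Ideal R) (hJ : J ≠ ⊥)
    (E : Type*) [Field E] [Algebra (Polynomial R) E] [IsFractionRing (Polynomial R) E] :
    IsFractionRing (reesAlgebra J) E := by
  obtain ⟨j, hj, hj0⟩ := Submodule.exists_mem_ne_zero_of_ne_bot hJ
  have hinj : Function.Injective (algebraMap (reesAlgebra J) E) :=
    (IsFractionRing.injective (Polynomial R) E).comp Subtype.val_injective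
  have : FaithfulSMul (reesAlgebra J) E := (faithfulSMul_iff_algebraMap_injective _ E).2 hinj
  refine IsFractionRing.of_field _ _ ?_
  intro z
  obtain ⟨P, Q, hQ, rfl⟩ := IsFractionRing.div_surjective (A := Polynomial R) z
  have key : ∀ (N : ℕ) (P : Polynomial R), P.natDegree ≤ N →
      Polynomial.C (j ^ N) * P ∈ reesAlgebra J := by
    intro N P hP i
    rw [Polynomial.coeff_C_mul]
    by_cases hi : i ≤ N
    · exact Ideal.mul_mem_right _ _ (Ideal.pow_le_pow_right hi (Ideal.pow_mem_pow hj N))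
    · rw [Polynomial.coeff_eq_zero_of_natDegree_lt (by omega), mul_zero]
      exact zero_mem _
  let N := max P.natDegree Q.natDegree
  refine ⟨⟨_, key N P (le_max_left _ _)⟩, ⟨_, key N Q (le_max_right _ _)⟩, ?_⟩
  change _ = algebraMap (Polynomial R) E (Polynomial.C (j ^ N) * P) /
    algebraMap (Polynomial R) E (Polynomial.C (j ^ N) * Q)
  rw [map_mul, map_mul, mul_div_mul_left]
  rw [Ne, map_eq_zero_iff _ (IsFractionRing.injective (Polynomial R) E)]
  simpa using fun h => absurd h hj0

lemma rees_bound (K : Type*) {R : Type*} [Field K] [CharZero K] [CommRing R] [IsDomain R]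
    [Algebra K R] [Algebra.FiniteType K R] (J : Ideal R) (hJ : J ≠ ⊥)
    (E : Type*) [Field E] [Algebra (Polynomial R) E] [IsFractionRing (Polynomial R) E] :
    ∃ c : ℕ, ∀ k f, IsIntegral (reesAlgebra J) (algebraMap (Polynomial R) E
      (Polynomial.monomial k f)) → f ∈ J ^ (k - c) := by
  classical
  have := rees_isFractionRing J hJ E
  have : IsNoetherianRing R := Algebra.FiniteType.isNoetherianRing K R
  have : Algebra.FiniteType R (reesAlgebra J) := inferInstance
  have : Algebra.FiniteType K (reesAlgebra J) :=
    Algebra.FiniteType.trans (S := R) inferInstance inferInstance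
  have hfin : Module.Finite (reesAlgebra J) (integralClosure (reesAlgebra J) E) :=
    finite_integralClosure K (reesAlgebra J) E
  have hfg : (Subalgebra.toSubmodule (integralClosure (reesAlgebra J) E)).FG :=
    Module.Finite.iff_fg.1 hfin
  let L : Polynomial R →ₗ[reesAlgebra J] E :=
    (Algebra.linearMap (Polynomial R) E).restrictScalars (reesAlgebra J)
  let M : Submodule (reesAlgebra J) E :=
    Subalgebra.toSubmodule (integralClosure (reesAlgebra J) E) ⊓ LinearMap.range L
  have hM : M.FG := by
    have h1 : IsNoetherian (reesAlgebra J)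
      (Subalgebra.toSubmodule (integralClosure (reesAlgebra J) E)) :=
      isNoetherian_of_fg_of_noetherian _ hfg
    exact (isNoetherian_submodule.1 h1) M inf_le_left
  obtain ⟨G, hG⟩ := hM
  have hGr : ∀ g ∈ G, ∃ P : Polynomial R, L P = g := fun g hg => by
    have : g ∈ M := hG ▸ Submodule.subset_span hg
    exact this.2
  choose! P hP using hGr
  refine ⟨G.sup fun g => (P g).natDegree, fun k f hf => ?_⟩
  set c := G.sup fun g => (P g).natDegree
  have hx : algebraMap (Polynomial R) E (Polynomial.monomial k f) ∈
      Submodule.span (reesAlgebra J) (G : Set E) := by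
    rw [hG]
    exact ⟨hf, _, rfl⟩
  have hall : ∃ Q : Polynomial R, algebraMap (Polynomial R) E Q =
      algebraMap (Polynomial R) E (Polynomial.monomial k f) ∧ ∀ i, Q.coeff i ∈ J ^ (i - c) := by
    refine Submodule.span_induction (p := fun x _ => ∃ Q : Polynomial R,
      algebraMap (Polynomial R) E Q = x ∧ ∀ i, Q.coeff i ∈ J ^ (i - c)) ?_ ?_ ?_ ?_ hx
    · intro g hg
      refine ⟨P g, hP g hg, fun i => ?_⟩
      by_cases hi : i ≤ c
      · rw [Nat.sub_eq_zero_of_le hi]; simp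
      · have : (P g).natDegree ≤ c := Finset.le_sup (f := fun g => (P g).natDegree) hg
        rw [Polynomial.coeff_eq_zero_of_natDegree_lt (by omega)]
        exact zero_mem _
    · exact ⟨0, by simp, by simp⟩
    · rintro x y _ _ ⟨Q, rfl, hQ⟩ ⟨Q', rfl, hQ'⟩
      exact ⟨Q + Q', by simp, fun i => by
        rw [Polynomial.coeff_add]; exact add_mem (hQ i) (hQ' i)⟩
    · rintro ⟨b, hb⟩ x _ ⟨Q, rfl, hQ⟩
      refine ⟨b * Q, ?_, fun i => ?_⟩
      · rw [map_mul, Algebra.smul_def]; rfl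
      · rw [Polynomial.coeff_mul]
        refine Ideal.sum_mem _ fun z hz => ?_
        have hz' := Finset.HasAntidiagonal.mem_antidiagonal.1 hz
        have := Ideal.mul_mem_mul (hb z.1) (hQ z.2)
        rw [← pow_add] at this
        exact Ideal.pow_le_pow_right (by omega) this
  obtain ⟨Q, hQ, hQc⟩ := hall
  have hQ' := IsFractionRing.injective (Polynomial R) E hQ
  have := hQc k
  rw [hQ'] at this
  simpa using this

lemma isIntegral_rees_of_closure {R : Type*} [CommRing R] [IsDomain R] (J : Ideal R)
    (E : Type*) [Field E] [Algebra (Polynomial R) E] [IsFractionRing (Polynomial R) E] (x : E)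
    (hx : x ∈ integralClosure (Subring.closure
      (algebraMap (Polynomial R) E '' (reesAlgebra J : Set (Polynomial R)))) E) :
    IsIntegral (reesAlgebra J) x := by
  have hinj : Function.Injective (algebraMap (reesAlgebra J) E) :=
    (IsFractionRing.injective (Polynomial R) E).comp Subtype.val_injective
  let e : reesAlgebra J ≃+* (algebraMap (reesAlgebra J) E).range :=
    RingEquiv.ofBijective (algebraMap (reesAlgebra J) E).rangeRestrict
      ⟨fun a b h => hinj (congrArg Subtype.val h), RingHom.rangeRestrict_surjective _⟩
  have hle : Subring.closure
      (algebraMap (Polynomial R) E '' (reesAlgebra J : Set (Polynomial R))) ≤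
      (algebraMap (reesAlgebra J) E).range := by
    rw [Subring.closure_le]
    rintro _ ⟨b, hb, rfl⟩
    exact ⟨⟨b, hb⟩, rfl⟩
  refine IsIntegral.map_of_comp_eq (e.symm.toRingHom.comp (Subring.inclusion hle))
    (RingHom.id E) ?_ hx
  ext y
  have : algebraMap (reesAlgebra J) E (e.symm (Subring.inclusion hle y)) =
      ((e (e.symm (Subring.inclusion hle y)) : (algebraMap (reesAlgebra J) E).range) : E) := rfl
  change algebraMap (reesAlgebra J) E (e.symm (Subring.inclusion hle y)) = y
  rw [this, e.apply_symm_apply]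
  rfl

lemma symbolic_le (K : Type*) [Field K] [CharZero K] (p n q s r : ℕ) (hp : 1 ≤ p)
    (hpn : q + p ≤ n) (hsr : r * ((q + 1) * p) ≤ s * (q + p)) :
    ∃ c : ℕ, ∀ k, symbolicPower (genericMinors K (q + p) n (q + 1)) (s * k) ≤
      genericMinors K (q + p) n (q + 1) ^ (r * (k - c)) := by
  have hI : genericMinors K (q + p) n (q + 1) ≠ ⊥ := by
    intro h
    have hmem : Matrix.det (Matrix.of fun i j => (MvPolynomial.X
        (Fin.castLE (by omega : q + 1 ≤ q + p) i, Fin.castLE (by omega : q + 1 ≤ n) j) :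
        MvPolynomial (Fin (q + p) × Fin n) K)) ∈ genericMinors K (q + p) n (q + 1) :=
      Ideal.subset_span ⟨_, _, Fin.castLE_injective _, Fin.castLE_injective _, rfl⟩
    rw [h] at hmem
    exact minor_ne_zero _ _ (Fin.castLE_injective _) (Fin.castLE_injective _) hmem
  obtain ⟨c, hc⟩ := rees_bound K (genericMinors K (q + p) n (q + 1) ^ r) (pow_ne_zero r hI)
    (FractionRing (Polynomial (MvPolynomial (Fin (q + p) × Fin n) K)))
  refine ⟨c, fun k f hf => ?_⟩
  rw [pow_mul]
  exact hc k f (isIntegral_rees_of_closure _ _ _ (integral_main p n q s r hp hsr _ k f hf))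

lemma eventually_le (K : Type*) [Field K] [CharZero K] (p n q s r : ℕ) (hp : 1 ≤ p)
    (hpn : q + p ≤ n) (hsr : r * ((q + 1) * p) < s * (q + p)) :
    ¬ ∀ᶠ T in atTop, ¬ symbolicPower (genericMinors K (q + p) n (q + 1)) (s * T) ≤
      genericMinors K (q + p) n (q + 1) ^ (r * T) := by
  intro h
  obtain ⟨T0, hT0⟩ := eventually_atTop.1 h
  let N := (q + 1) * p
  have hN : 1 ≤ N := Nat.mul_pos (by omega) hp
  obtain ⟨c, hc⟩ := symbolic_le K p n q (s * N) (r * N + 1) hp hpn (by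
    calc (r * N + 1) * ((q + 1) * p) = (r * ((q + 1) * p) + 1) * N := by
          ring
      _ ≤ s * (q + p) * N := Nat.mul_le_mul_right _ hsr
      _ = _ := by ring)
  let k := T0 + c * (r * N + 1)
  refine hT0 (N * k) ?_ ?_
  · calc T0 ≤ k := Nat.le_add_right _ _
      _ ≤ N * k := Nat.le_mul_of_pos_left _ hN
  · have := hc k
    rw [← mul_assoc]
    refine this.trans (Ideal.pow_le_pow_right ?_)
    have hck : c ≤ k := (Nat.le_mul_of_pos_right c (by omega)).trans (Nat.le_add_left _ _)
    have h2 : c * (r * N + 1) ≤ k := Nat.le_add_left _ _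
    rw [Nat.mul_sub]
    apply Nat.le_sub_of_add_le
    calc r * (N * k) + (r * N + 1) * c = r * N * k + c * (r * N + 1) := by ring
      _ ≤ r * N * k + k := Nat.add_le_add_left h2 _
      _ = _ := by ring

/-! ### Final assembly -/

lemma eventually_not_le (K : Type*) [Field K] (p n q s r : ℕ) (hp : 1 ≤ p)
    (hpn : q + p ≤ n) (hsr : s * (q + p) < r * ((q + 1) * p)) :
    ∀ᶠ T in atTop, ¬ symbolicPower (genericMinors K (q + p) n (q + 1)) (s * T) ≤
      genericMinors K (q + p) n (q + 1) ^ (r * T) := by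
  refine eventually_atTop.2 ⟨(q + p) * p + 1, fun T hT hle => ?_⟩
  let k := s * T / p + 1
  have h1 : s * T ≤ p * k := (Nat.lt_mul_div_succ (s * T) hp).le
  have h2 : p * k ≤ s * T + p := by
    have := Nat.mul_div_le (s * T) p
    simp only [k, mul_add, mul_one]; omega
  obtain ⟨hh, h0⟩ := maxMinor_pow_homog K (q + p) n hpn k
  have h3 := degree_ge_of_mem_pow (hle (maxMinor_pow_mem K p n q hpn k (s * T) h1)) hh h0
  have h4 : (q + 1) * (r * T) * p ≤ (q + p) * (s * T + p) := by
    calc (q + 1) * (r * T) * p ≤ (q + p) * k * p := Nat.mul_le_mul_right _ h3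
      _ = (q + p) * (p * k) := by ring
      _ ≤ _ := Nat.mul_le_mul_left _ h2
  have h5 : (s * (q + p) + 1) * T ≤ (r * ((q + 1) * p)) * T := Nat.mul_le_mul_right _ hsr
  have h6 : (r * ((q + 1) * p)) * T = (q + 1) * (r * T) * p := by ring
  have h7 : (s * (q + p) + 1) * T = (q + p) * (s * T) + T := by ring
  rw [mul_add] at h4
  omega

lemma asymp_eq (K : Type*) [Field K] [CharZero K] (p n q : ℕ) (hp : 1 ≤ p)
    (hpn : q + p ≤ n) :
    asympResurgence (genericMinors K (q + p) n (q + 1)) =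
      (((q + 1) * p : ℕ) : ℝ) / ((q + p : ℕ) : ℝ) := by
  have hm : (0 : ℝ) < ((q + p : ℕ) : ℝ) := by
    exact_mod_cast (by omega : 0 < q + p)
  have hL : (0 : ℝ) < (((q + 1) * p : ℕ) : ℝ) / ((q + p : ℕ) : ℝ) := by
    apply div_pos _ hm
    exact_mod_cast Nat.mul_pos (by omega) hp
  have hex : ∀ w : ℝ, w < (((q + 1) * p : ℕ) : ℝ) / ((q + p : ℕ) : ℝ) →
      ∃ a ∈ {x : ℝ | ∃ s r : ℕ, 0 < s ∧ 0 < r ∧ x = (s : ℝ) / r ∧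
        ∀ᶠ T in atTop, ¬ symbolicPower (genericMinors K (q + p) n (q + 1)) (s * T) ≤
          genericMinors K (q + p) n (q + 1) ^ (r * T)}, w < a := by
    intro w hw
    obtain ⟨x, hx1, hx2⟩ := exists_rat_btwn (max_lt hw hL)
    have hx0 : (0 : ℝ) < x := (le_max_right _ _).trans_lt hx1
    have hx0' : 0 < x := by exact_mod_cast hx0
    have hnum : 0 < x.num := Rat.num_pos.2 hx0'
    obtain ⟨s, hs⟩ := Int.eq_ofNat_of_zero_le hnum.le
    have hs0 : 0 < s := by omega
    have hxe : (x : ℝ) = (s : ℝ) / (x.den : ℝ) := by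
      rw [Rat.cast_def, hs]; simp
    have hd : (0 : ℝ) < (x.den : ℝ) := by exact_mod_cast x.den_pos
    refine ⟨x, ⟨s, x.den, hs0, x.den_pos, hxe, ?_⟩, (le_max_left _ _).trans_lt hx1⟩
    apply eventually_not_le K p n q s x.den hp hpn
    rw [hxe, div_lt_div_iff₀ hd hm] at hx2
    rw [mul_comm x.den]
    exact_mod_cast hx2
  unfold asympResurgence
  refine csSup_eq_of_forall_le_of_forall_lt_exists_gt ?_ ?_ hex
  · obtain ⟨a, ha, -⟩ := hex 0 hL
    exact ⟨a, ha⟩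
  · rintro _ ⟨s, r, hs, hr, rfl, h⟩
    by_contra hlt
    push Not at hlt
    have hr' : (0 : ℝ) < (r : ℝ) := by exact_mod_cast hr
    rw [div_lt_div_iff₀ hm hr'] at hlt
    refine eventually_le K p n q s r hp hpn ?_ h
    rw [mul_comm r]
    exact_mod_cast hlt

lemma alpha_gm (K : Type*) [Field K] (m n t : ℕ) (htm : t ≤ m) (hmn : m ≤ n) :
    alphaDeg (genericMinors K m n t) = t := by
  have hmem : t ∈ {d | ∃ f ∈ genericMinors K m n t, f ≠ 0 ∧ MvPolynomial.IsHomogeneous f d} := by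
    refine ⟨_, Ideal.subset_span ⟨Fin.castLE htm, Fin.castLE (htm.trans hmn),
      Fin.castLE_injective _, Fin.castLE_injective _, rfl⟩,
      minor_ne_zero _ _ (Fin.castLE_injective _) (Fin.castLE_injective _),
      isHomogeneous_minor _ _⟩
  refine le_antisymm (Nat.sInf_le hmem) ?_
  refine le_csInf ⟨t, hmem⟩ ?_
  rintro d ⟨f, hf, h0, hd⟩
  have := degree_ge_of_mem_pow (e := 1) (by simpa using hf) hd h0
  simpa using this

lemma alpha_sym_bounds (K : Type*) [Field K] (p n q s : ℕ) (hp : 1 ≤ p) (hpn : q + p ≤ n) :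
    (q + p) * s ≤ p * alphaDeg (symbolicPower (genericMinors K (q + p) n (q + 1)) s) ∧
    p * alphaDeg (symbolicPower (genericMinors K (q + p) n (q + 1)) s) ≤
      (q + p) * s + (q + p) * p := by
  let k := s / p + 1
  have h1 : s ≤ p * k := (Nat.lt_mul_div_succ s hp).le
  have h2 : p * k ≤ s + p := by
    have := Nat.mul_div_le s p
    simp only [k, mul_add, mul_one]; omega
  obtain ⟨hh, h0⟩ := maxMinor_pow_homog K (q + p) n hpn k
  have hmem : (q + p) * k ∈ {d | ∃ f ∈ symbolicPower (genericMinors K (q + p) n (q + 1)) s,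
      f ≠ 0 ∧ MvPolynomial.IsHomogeneous f d} :=
    ⟨_, maxMinor_pow_mem K p n q hpn k s h1, h0, hh⟩
  constructor
  · obtain ⟨f, hf, hf0, hd⟩ := Nat.sInf_mem ⟨_, hmem⟩
    exact alpha_lower K p n q s _ hp f hf hd hf0
  · have h3 : alphaDeg (symbolicPower (genericMinors K (q + p) n (q + 1)) s) ≤ (q + p) * k :=
      Nat.sInf_le hmem
    calc _ ≤ p * ((q + p) * k) := Nat.mul_le_mul_left _ h3
      _ = (q + p) * (p * k) := by ring
      _ ≤ (q + p) * (s + p) := Nat.mul_le_mul_left _ h2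
      _ = _ := by ring

lemma alpha_tendsto (K : Type*) [Field K] (p n q : ℕ) (hp : 1 ≤ p) (hpn : q + p ≤ n) :
    Tendsto (fun s : ℕ =>
        (alphaDeg (symbolicPower (genericMinors K (q + p) n (q + 1)) s) : ℝ) / s) atTop
      (nhds (((q + p : ℕ) : ℝ) / (p : ℝ))) := by
  have hp' : (0 : ℝ) < (p : ℝ) := by exact_mod_cast hp
  have hlim : Tendsto (fun s : ℕ => ((q + p : ℕ) : ℝ) / (p : ℝ) + ((q + p : ℕ) : ℝ) / (s : ℝ))
      atTop (nhds (((q + p : ℕ) : ℝ) / (p : ℝ))) := by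
    have := (tendsto_const_nhds (x := ((q + p : ℕ) : ℝ) / (p : ℝ)) (f := atTop)).add
      (tendsto_const_div_atTop_nhds_zero_nat ((q + p : ℕ) : ℝ))
    simpa using this
  refine tendsto_of_tendsto_of_tendsto_of_le_of_le' tendsto_const_nhds hlim ?_ ?_
  · filter_upwards [eventually_gt_atTop 0] with s hs
    have hs' : (0 : ℝ) < (s : ℝ) := by exact_mod_cast hs
    rw [div_le_div_iff₀ hp' hs', mul_comm _ (p : ℝ)]
    exact_mod_cast (alpha_sym_bounds K p n q s hp hpn).1
  · filter_upwards [eventually_gt_atTop 0] with s hs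
    have hs' : (0 : ℝ) < (s : ℝ) := by exact_mod_cast hs
    rw [div_add_div _ _ hp'.ne' hs'.ne', div_le_div_iff₀ hs' (mul_pos hp' hs')]
    have h : (p : ℝ) * (alphaDeg (symbolicPower (genericMinors K (q + p) n (q + 1)) s) : ℝ) ≤
        ((q + p : ℕ) : ℝ) * s + ((q + p : ℕ) : ℝ) * p := by
      exact_mod_cast (alpha_sym_bounds K p n q s hp hpn).2
    nlinarith [mul_le_mul_of_nonneg_right h hs'.le]

/-- Theorem 4.1(4): for the generic determinantal ideal `I_t(X)` with `m ≤ n`, the asymptotic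
resurgence of `I_t(X)` equals `α(I_t(X))/α̂(I_t(X)) = t(m-t+1)/m`. -/
theorem generic_determinantal_asymp_resurgence {K : Type*} [Field K] [CharZero K]
    (m n t : ℕ) (hmn : m ≤ n) (ht1 : 1 ≤ t) (htm : t ≤ m) :
    asympResurgence (genericMinors K m n t) = (t * (m - t + 1) : ℕ) / (m : ℝ) ∧
    ∃ W : ℝ, Tendsto (fun s : ℕ =>
        (alphaDeg (symbolicPower (genericMinors K m n t) s) : ℝ) / s) atTop (nhds W) ∧
      (alphaDeg (genericMinors K m n t) : ℝ) / W = (t * (m - t + 1) : ℕ) / (m : ℝ) := by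
  obtain ⟨q, rfl⟩ : ∃ q, t = q + 1 := ⟨t - 1, by omega⟩
  obtain ⟨p, rfl, hp⟩ : ∃ p, m = q + p ∧ 1 ≤ p := ⟨m - q, by omega, by omega⟩
  have he : q + p - (q + 1) + 1 = p := by omega
  rw [he]
  refine ⟨asymp_eq K p n q hp hmn, _, alpha_tendsto K p n q hp hmn, ?_⟩
  rw [alpha_gm K (q + p) n (q + 1) htm hmn, div_div_eq_mul_div]
  push_cast
  ring
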